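/- arXiv:1901.03980 — 3 statements merged into one kernel-verified Lean document; each statement's English description precedes it below -/
import Mathlib

section
/- Let G be a finite group with |G| ≥ 3, let l ∈ ℕ_0 and j ∈ [0, D(G) - 1] be such that l·D(G) + j ≥ 1. Then λ_{l·D(G)+j}(G) = 2l if j = 0; λ_{l·D(G)+j}(G) = 2l + 1 if j ∈ [1, ρ_{2l+1}(G) - l·D(G)]; and λ_{l·D(G)+j}(G) = 2l + 2 if j ∈ [ρ_{2l+1}(G) - l·D(G) + 1, D(G) - 1]. -/
/-- A multiset over a group is a *product-one sequence* if its terms can be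
ordered so that their product is `1`. -/
def IsProductOne {G : Type*} [Group G] (S : Multiset G) : Prop :=
  ∃ l : List G, (l : Multiset G) = S ∧ l.prod = 1

/-- A product-one sequence is *minimal* (an atom of `B(G)`) if it is non-trivial
and cannot be written as a concatenation of two non-trivial product-one
sequences. -/
def IsMinimalProductOne {G : Type*} [Group G] (S : Multiset G) : Prop :=
  S ≠ 0 ∧ IsProductOne S ∧
    ∀ T₁ T₂ : Multiset G, T₁ ≠ 0 → T₂ ≠ 0 → IsProductOne T₁ → IsProductOne T₂ →
      S ≠ T₁ + T₂

/-- The large Davenport constant `D(G)`: the maximal length of a minimal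
product-one sequence over `G`. -/
noncomputable def DavenportLarge (G : Type*) [Group G] : ℕ :=
  sSup {m | ∃ S : Multiset G, IsMinimalProductOne S ∧ Multiset.card S = m}

/-- `k ∈ L(a)`: the product-one sequence `a` is a concatenation of `k` minimal
product-one sequences. -/
def HasLength {G : Type*} [Group G] (a : Multiset G) (k : ℕ) : Prop :=
  ∃ f : Fin k → Multiset G, (∀ i, IsMinimalProductOne (f i)) ∧ (∑ i, f i) = a

/-- `U_k(G)`: the union of all sets of lengths `L(a)` with `k ∈ L(a)`. -/
def UnionLengths (G : Type*) [Group G] (k : ℕ) : Set ℕ :=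
  {m | ∃ a : Multiset G, IsProductOne a ∧ HasLength a k ∧ HasLength a m}

/-- `ρ_k(G) = sup U_k(G)`. -/
noncomputable def rhoK (G : Type*) [Group G] (k : ℕ) : ℕ :=
  sSup (UnionLengths G k)

/-- `λ_k(G) = min U_k(G)`. -/
noncomputable def lambdaK (G : Type*) [Group G] (k : ℕ) : ℕ :=
  sInf (UnionLengths G k)

namespace LV

variable {G : Type*} [Group G]

/-- Multiset version of `HasLength`. -/
def HL (a : Multiset G) (k : ℕ) : Prop :=
  ∃ M : Multiset (Multiset G), M.card = k ∧ (∀ A ∈ M, IsMinimalProductOne A) ∧ M.sum = a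

lemma hasLength_iff (a : Multiset G) (k : ℕ) : HasLength a k ↔ HL a k := by
  constructor
  · rintro ⟨f, hf, rfl⟩
    refine ⟨(Finset.univ : Finset (Fin k)).val.map f, by simp, ?_, rfl⟩
    intro A hA
    obtain ⟨i, -, rfl⟩ := Multiset.mem_map.1 hA
    exact hf i
  · rintro ⟨M, rfl, hM, rfl⟩
    induction M using Quotient.inductionOn with
    | h L =>
      refine ⟨fun i => L.get i, fun i => hM _ (List.get_mem L i), ?_⟩
      simp only [Multiset.quot_mk_to_coe, Multiset.sum_coe]
      have := List.sum_ofFn (f := fun i : Fin L.length => L.get i)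
      rw [List.ofFn_get] at this
      exact this.symm

lemma isProductOne_add {S T : Multiset G} (hS : IsProductOne S) (hT : IsProductOne T) :
    IsProductOne (S + T) := by
  obtain ⟨l, rfl, hl⟩ := hS
  obtain ⟨m, rfl, hm⟩ := hT
  exact ⟨l ++ m, by simp, by simp [hl, hm]⟩

lemma isProductOne_zero : IsProductOne (0 : Multiset G) := ⟨[], by simp, by simp⟩

lemma HL.isProductOne {a : Multiset G} {k : ℕ} (h : HL a k) : IsProductOne a := by
  obtain ⟨M, -, hM, rfl⟩ := h
  induction M using Multiset.induction with
  | empty => exact isProductOne_zero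
  | cons A M ih =>
    rw [Multiset.sum_cons]
    exact isProductOne_add (hM A (by simp)).2.1 (ih fun B hB => hM B (by simp [hB]))

lemma mem_msum {x : G} {M : Multiset (Multiset G)} (h : x ∈ M.sum) : ∃ U ∈ M, x ∈ U := by
  induction M using Multiset.induction with
  | empty => simp at h
  | cons A M ih =>
    rw [Multiset.sum_cons, Multiset.mem_add] at h
    rcases h with h | h
    · exact ⟨A, by simp, h⟩
    · obtain ⟨U, hU, hx⟩ := ih h
      exact ⟨U, by simp [hU], hx⟩

/-- Symmetric form of membership in `UnionLengths`. -/
def UL (G : Type*) [Group G] (k m : ℕ) : Prop := ∃ a : Multiset G, HL a k ∧ HL a m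

lemma mem_unionLengths (k m : ℕ) : m ∈ UnionLengths G k ↔ UL G k m := by
  constructor
  · rintro ⟨a, -, h1, h2⟩
    exact ⟨a, (hasLength_iff _ _).1 h1, (hasLength_iff _ _).1 h2⟩
  · rintro ⟨a, h1, h2⟩
    exact ⟨a, h1.isProductOne, (hasLength_iff _ _).2 h1, (hasLength_iff _ _).2 h2⟩

lemma UL.symm {k m : ℕ} (h : UL G k m) : UL G m k := by
  obtain ⟨a, h1, h2⟩ := h
  exact ⟨a, h2, h1⟩

lemma HL.add {a b : Multiset G} {k m : ℕ} (h : HL a k) (h' : HL b m) : HL (a + b) (k + m) := by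
  obtain ⟨M, rfl, hM, rfl⟩ := h
  obtain ⟨N, rfl, hN, rfl⟩ := h'
  refine ⟨M + N, by simp, ?_, by simp⟩
  intro A hA
  rcases Multiset.mem_add.1 hA with h | h
  · exact hM A h
  · exact hN A h

lemma UL.add {k m k' m' : ℕ} (h : UL G k m) (h' : UL G k' m') : UL G (k + k') (m + m') := by
  obtain ⟨a, h1, h2⟩ := h
  obtain ⟨b, h3, h4⟩ := h'
  exact ⟨a + b, h1.add h3, h2.add h4⟩

lemma HL.zero : HL (0 : Multiset G) 0 := ⟨0, by simp, by simp, by simp⟩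

lemma HL.single {A : Multiset G} (h : IsMinimalProductOne A) : HL A 1 :=
  ⟨{A}, by simp, by simpa using h, by simp⟩

lemma UL.mul {k m : ℕ} (h : UL G k m) (n : ℕ) : UL G (n * k) (n * m) := by
  induction n with
  | zero =>
    rw [Nat.zero_mul, Nat.zero_mul]
    exact ⟨0, HL.zero, HL.zero⟩
  | succ n ih =>
    rw [Nat.succ_mul, Nat.succ_mul]
    exact ih.add h

lemma isProductOne_one : IsProductOne ({1} : Multiset G) := ⟨[1], by simp, by simp⟩

lemma atom_one : IsMinimalProductOne ({1} : Multiset G) := by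
  refine ⟨by simp, isProductOne_one, ?_⟩
  intro S T hS hT _ _ h
  have := congrArg Multiset.card h
  have h1 := Multiset.card_pos.2 hS
  have h2 := Multiset.card_pos.2 hT
  simp at this
  omega

lemma UL.one : UL G 1 1 := ⟨{1}, HL.single atom_one, HL.single atom_one⟩

lemma UL.refl (k : ℕ) : UL G k k := by simpa using (UL.one (G := G)).mul k

/-- Removing a product-one part whose complement is product-one. -/
lemma atom_one_mem {A : Multiset G} (h : IsMinimalProductOne A) (h1 : (1 : G) ∈ A) : A = {1} := by
  classical
  obtain ⟨B, rfl⟩ := Multiset.exists_cons_of_mem h1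
  by_contra hne
  have hB : B ≠ 0 := by
    rintro rfl
    exact hne rfl
  obtain ⟨l, hl, hp⟩ := h.2.1
  have hmem : (1 : G) ∈ l := by
    rw [← Multiset.mem_coe, hl]
    simp
  obtain ⟨p, q, rfl⟩ := List.append_of_mem hmem
  refine h.2.2 {1} B (by simp) hB isProductOne_one ⟨p ++ q, ?_, by simpa using hp⟩ rfl
  have : ((1 : G) ::ₘ ((p ++ q : List G) : Multiset G)) = 1 ::ₘ B := by
    rw [← hl, Multiset.cons_coe, Multiset.coe_eq_coe]
    exact List.perm_middle.symm
  exact (Multiset.cons_inj_right _).1 this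

/-- Every product-one sequence factors into atoms. -/
lemma exists_HL (B : Multiset G) (hB : IsProductOne B) : ∃ s, HL B s := by
  induction hn : B.card using Nat.strong_induction_on generalizing B with
  | _ n ih =>
    by_cases h0 : B = 0
    · subst h0
      exact ⟨0, HL.zero⟩
    by_cases ha : IsMinimalProductOne B
    · exact ⟨1, HL.single ha⟩
    unfold IsMinimalProductOne at ha
    push Not at ha
    obtain ⟨S, T, hS, hT, pS, pT, rfl⟩ := ha h0 hB
    have h1 := Multiset.card_pos.2 hS
    have h2 := Multiset.card_pos.2 hT
    rw [Multiset.card_add] at hn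
    obtain ⟨s, hs⟩ := ih S.card (by omega) S pS rfl
    obtain ⟨t, ht⟩ := ih T.card (by omega) T pT rfl
    exact ⟨s + t, hs.add ht⟩

lemma HL.pos {B : Multiset G} {s : ℕ} (h : HL B s) (hB : B ≠ 0) : 1 ≤ s := by
  obtain ⟨M, rfl, -, rfl⟩ := h
  refine Multiset.card_pos.2 ?_
  rintro rfl
  simp at hB

/-- Contracting two adjacent letters of an atom gives an atom. -/
lemma atom_contract {p q : List G} {g h : G}
    (hA : IsMinimalProductOne ((p ++ g :: h :: q : List G) : Multiset G))
    (hprod : (p ++ g :: h :: q).prod = 1) :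
    IsMinimalProductOne ((p ++ (g * h) :: q : List G) : Multiset G) := by
  classical
  -- if a product-one `S` contains `g * h`, it can be expanded
  have expand : ∀ S : Multiset G, IsProductOne ((g * h) ::ₘ S) →
      IsProductOne (g ::ₘ h ::ₘ S) := by
    rintro S ⟨l, hl, hlp⟩
    have hmem : g * h ∈ l := by
      rw [← Multiset.mem_coe, hl]
      simp
    obtain ⟨u, v, rfl⟩ := List.append_of_mem hmem
    have hS : ((u ++ v : List G) : Multiset G) = S := by
      refine (Multiset.cons_inj_right (g * h)).1 ?_
      rw [← hl, Multiset.cons_coe, Multiset.coe_eq_coe]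
      exact List.perm_middle.symm
    refine ⟨u ++ g :: h :: v, ?_, by simpa [mul_assoc] using hlp⟩
    rw [← hS, Multiset.cons_coe, Multiset.cons_coe, Multiset.coe_eq_coe]
    exact List.perm_middle.trans (List.Perm.cons _ List.perm_middle)
  have e1 : ((p ++ (g * h) :: q : List G) : Multiset G) = (g * h) ::ₘ ((p ++ q : List G) : Multiset G) := by
    rw [Multiset.cons_coe, Multiset.coe_eq_coe]
    exact List.perm_middle
  have e2 : ((p ++ g :: h :: q : List G) : Multiset G) =
      g ::ₘ h ::ₘ ((p ++ q : List G) : Multiset G) := by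
    rw [Multiset.cons_coe, Multiset.cons_coe, Multiset.coe_eq_coe]
    exact List.perm_middle.trans (List.Perm.cons _ List.perm_middle)
  refine ⟨by simp [e1], ⟨_, rfl, by simpa [mul_assoc] using hprod⟩, ?_⟩
  -- main argument, one side
  have key : ∀ S T : Multiset G, T ≠ 0 → IsProductOne S → IsProductOne T → g * h ∈ S →
      ((p ++ (g * h) :: q : List G) : Multiset G) ≠ S + T := by
    intro S T hT pS pT hm he
    obtain ⟨S', rfl⟩ := Multiset.exists_cons_of_mem hm
    rw [e1, Multiset.cons_add] at he
    have he' := (Multiset.cons_inj_right _).1 he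
    refine hA.2.2 (g ::ₘ h ::ₘ S') T (by simp) hT (expand S' pS) pT ?_
    rw [e2, he']
    simp
  intro S T hS hT pS pT he
  have : g * h ∈ S + T := by
    rw [← he, e1]
    simp
  rcases Multiset.mem_add.1 this with hm | hm
  · exact key S T hT pS pT hm he
  · exact key T S hS pT pS hm (by rw [he, add_comm])

/-- A product-one sequence can be ordered to begin with any prescribed letter. -/
lemma exists_head {g : G} {S : Multiset G} (h : IsProductOne (g ::ₘ S)) :
    ∃ l : List G, (l : Multiset G) = S ∧ g * l.prod = 1 := by
  classical
  obtain ⟨l, hl, hlp⟩ := h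
  have hmem : g ∈ l := by
    rw [← Multiset.mem_coe, hl]
    simp
  obtain ⟨u, v, rfl⟩ := List.append_of_mem hmem
  refine ⟨v ++ u, ?_, ?_⟩
  · refine (Multiset.cons_inj_right g).1 ?_
    rw [← hl, Multiset.cons_coe, Multiset.coe_eq_coe]
    exact (List.Perm.cons _ List.perm_append_comm).trans List.perm_middle.symm
  · rw [List.prod_append, List.prod_cons] at hlp
    rw [List.prod_append, ← mul_assoc]
    exact mul_eq_one_comm.1 hlp

lemma merge {g h : G} {S T : Multiset G} (hS : IsProductOne (g ::ₘ S))
    (hT : IsProductOne (h ::ₘ T)) : IsProductOne ((g * h) ::ₘ (S + T)) := by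
  obtain ⟨l, rfl, hl⟩ := exists_head hS
  obtain ⟨m, rfl, hm⟩ := exists_head hT
  refine ⟨(g * h) :: (m ++ l), ?_, ?_⟩
  · rw [← Multiset.cons_coe, ← Multiset.coe_add, add_comm]
  · rw [List.prod_cons, List.prod_append]
    calc g * h * (m.prod * l.prod) = g * (h * m.prod) * l.prod := by group
      _ = 1 := by rw [hm, mul_one, hl]

/-- If no adjacent letters lie in different classes, all letters lie in one class. -/
lemma chain {ι : Type*} (V : ι → Multiset G) (L : List G) (hlen : 2 ≤ L.length)
    (hcov : ∀ x ∈ L, ∃ i, x ∈ V i)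
    (hadj : ∀ p q g h, L = p ++ g :: h :: q → ∀ i i', g ∈ V i → h ∈ V i' → i = i') :
    ∃ m, ∀ x ∈ L, ∀ i, x ∈ V i → i = m := by
  induction L with
  | nil => simp at hlen
  | cons x L ih =>
    cases L with
    | nil => simp at hlen
    | cons y L =>
      have hxy := hadj [] L x y rfl
      have tail : ∃ m, y ∈ V m ∧ ∀ z ∈ y :: L, ∀ i, z ∈ V i → i = m := by
        cases L with
        | nil =>
          obtain ⟨m, hm⟩ := hcov y (by simp)
          obtain ⟨n, hn⟩ := hcov x (by simp)
          refine ⟨m, hm, ?_⟩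
          intro z hz i hi
          simp at hz
          subst hz
          rw [← hxy n i hn hi, hxy n m hn hm]
        | cons z L =>
          obtain ⟨m, hm⟩ := ih (by simp) (fun w hw => hcov w (by simp [hw]))
            (fun p q g h e => hadj (x :: p) q g h (by rw [e]; rfl))
          obtain ⟨n, hn⟩ := hcov y (by simp)
          have := hm y (by simp) n hn
          subst this
          exact ⟨n, hn, hm⟩
      obtain ⟨m, hm, h⟩ := tail
      refine ⟨m, ?_⟩
      intro z hz i hi
      rcases List.mem_cons.1 hz with rfl | hz
      · exact hxy i m hi hm
      · exact h z hz i hi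

lemma exists_two {α : Type*} (L : List α) (i j : Fin L.length) (h : i ≠ j) :
    ∃ R : Multiset α, (L : Multiset α) = L.get i ::ₘ L.get j ::ₘ R := by
  classical
  have h1 : (L : Multiset α) = (Finset.univ : Finset (Fin L.length)).val.map L.get := by
    have : (Finset.univ : Finset (Fin L.length)).val.map L.get = (List.ofFn L.get : Multiset α) := by
      rw [Fin.univ_val_map]
    rw [this, List.ofFn_get]
  have h2 : (Finset.univ : Finset (Fin L.length)).val =
      i ::ₘ j ::ₘ (((Finset.univ : Finset (Fin L.length)).val.erase i).erase j) := by
    rw [Multiset.cons_erase, Multiset.cons_erase]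
    · simp
    · rw [Multiset.mem_erase_of_ne h.symm]
      simp
  refine ⟨(((Finset.univ : Finset (Fin L.length)).val.erase i).erase j).map L.get, ?_⟩
  conv_lhs => rw [h1, h2]
  simp

/-- Finding the pair to contract. -/
lemma exists_pair (M N : Multiset (Multiset G)) (hM : ∀ A ∈ M, IsMinimalProductOne A)
    (hN : ∀ A ∈ N, IsMinimalProductOne A) (hsum : M.sum = N.sum) (hcard : M.card < N.card)
    (hone : (1 : G) ∉ M.sum) :
    ∃ (p q : List G) (g h : G) (M' N' : Multiset (Multiset G)) (S T : Multiset G),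
      (p ++ g :: h :: q).prod = 1 ∧
      M = ((p ++ g :: h :: q : List G) : Multiset G) ::ₘ M' ∧
      N = (g ::ₘ S) ::ₘ (h ::ₘ T) ::ₘ N' := by
  classical
  by_contra hcon
  induction N using Quotient.inductionOn with
  | h L =>
  simp only [Multiset.quot_mk_to_coe] at *
  have hs : ∀ i : Fin L.length, ∃ U ∈ M, ∃ g ∈ U, g ∈ L.get i := by
    intro i
    have hi := hN (L.get i) (by simp)
    obtain ⟨g, hg⟩ := Multiset.exists_mem_of_ne_zero hi.1
    have : g ∈ M.sum := by
      rw [hsum]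
      exact Multiset.mem_of_le (Multiset.single_le_sum (fun _ _ => Multiset.zero_le _) _
        (by simp : L.get i ∈ (L : Multiset (Multiset G)))) hg
    obtain ⟨U, hU, hgU⟩ := mem_msum this
    exact ⟨U, hU, g, hgU, hg⟩
  -- uniqueness for each atom in `M`
  have huniq : ∀ U ∈ M, ∃ m : Fin L.length, ∀ x ∈ U, ∀ i, x ∈ L.get i → i = m := by
    intro U hU
    obtain ⟨M', rfl⟩ := Multiset.exists_cons_of_mem hU
    obtain ⟨l, rfl, hl⟩ := (hM U hU).2.1
    have := chain (fun i => L.get i) l ?_ ?_ ?_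
    · simpa using this
    · by_contra hlt
      have h0 := (hM _ hU).1
      match l, hl, h0 with
      | [], _, h0 => simp at h0
      | [x], hl, _ =>
        simp at hl
        subst hl
        simp at hone
      | _ :: _ :: _, _, _ => simp at hlt
    · intro x hx
      have : x ∈ (L : Multiset (Multiset G)).sum := by
        rw [← hsum]
        simp [hx]
      obtain ⟨V, hV, hxV⟩ := mem_msum this
      obtain ⟨i, rfl⟩ := List.mem_iff_get.1 (Multiset.mem_coe.1 hV)
      exact ⟨i, hxV⟩
    · intro p q g h e i i' hi hi'
      by_contra hne
      obtain ⟨R, hR⟩ := exists_two L i i' hne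
      obtain ⟨S, hS⟩ := Multiset.exists_cons_of_mem hi
      obtain ⟨T, hT⟩ := Multiset.exists_cons_of_mem hi'
      subst e
      exact hcon ⟨p, q, g, h, M', R, S, T, hl, rfl, by rw [← hS, ← hT]; exact hR⟩
  induction M using Quotient.inductionOn with
  | h K =>
  simp only [Multiset.quot_mk_to_coe, Multiset.mem_coe, Multiset.coe_card] at *
  have hs' : ∀ i : Fin L.length, ∃ s : Fin K.length, ∃ g ∈ K.get s, g ∈ L.get i := by
    intro i
    obtain ⟨U, hU, h⟩ := hs i
    obtain ⟨s, rfl⟩ := List.mem_iff_get.1 hU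
    exact ⟨s, h⟩
  choose s hs' using hs'
  obtain ⟨i, i', hne, he⟩ := Fintype.exists_ne_map_eq_of_card_lt s (by simpa using hcard)
  obtain ⟨m, hm⟩ := huniq (K.get (s i)) (by simp)
  obtain ⟨x, hx, hxi⟩ := hs' i
  obtain ⟨y, hy, hyi⟩ := hs' i'
  rw [← he] at hy
  exact hne ((hm x hx i hxi).trans (hm y hy i' hyi).symm)

/-- The unions of sets of lengths are intervals. -/
lemma interval (B : Multiset G) : ∀ k l j : ℕ, HL B k → HL B j → k ≤ l → l ≤ j → UL G k l := by
  classical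
  induction hn : B.card using Nat.strong_induction_on generalizing B with
  | _ n ih =>
  intro k l j hk hj hkl hlj
  rcases hkl.eq_or_lt with rfl | hkl'
  · exact UL.refl _
  rcases hlj.eq_or_lt with rfl | hlj'
  · exact ⟨B, hk, hj⟩
  obtain ⟨M, rfl, hM, rfl⟩ := hk
  obtain ⟨N, rfl, hN, hsum⟩ := hj
  by_cases hone : (1 : G) ∈ M.sum
  · have h1 : ∀ X : Multiset (Multiset G), (∀ A ∈ X, IsMinimalProductOne A) → (1 : G) ∈ X.sum →
        ∃ Y, X = {1} ::ₘ Y := by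
      intro X hX h
      obtain ⟨U, hU, h⟩ := mem_msum h
      obtain rfl := atom_one_mem (hX U hU) h
      exact Multiset.exists_cons_of_mem hU
    obtain ⟨M', rfl⟩ := h1 M hM hone
    obtain ⟨N', rfl⟩ := h1 N hN (by rw [hsum]; exact hone)
    have hs : N'.sum = M'.sum := by
      simpa using hsum
    have hc : M'.sum.card < n := by
      rw [← hn]
      simp
    simp only [Multiset.card_cons] at *
    have := ih _ hc M'.sum rfl M'.card (l - 1) N'.card
      ⟨M', rfl, fun A hA => hM A (by simp [hA]), rfl⟩
      ⟨N', rfl, fun A hA => hN A (by simp [hA]), hs⟩ (by omega) (by omega)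
    have := this.add UL.one
    rwa [Nat.sub_add_cancel (by omega)] at this
  · obtain ⟨p, q, g, h, M', N', S, T, hp, rfl, rfl⟩ :=
      exists_pair M N hM hN hsum.symm (by omega) hone
    have hA := atom_contract (hM _ (Multiset.mem_cons_self _ _)) hp
    have e1 : ((p ++ (g * h) :: q : List G) : Multiset G) =
        (g * h) ::ₘ ((p ++ q : List G) : Multiset G) := by
      rw [Multiset.cons_coe, Multiset.coe_eq_coe]
      exact List.perm_middle
    have e2 : ((p ++ g :: h :: q : List G) : Multiset G) =
        g ::ₘ h ::ₘ ((p ++ q : List G) : Multiset G) := by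
      rw [Multiset.cons_coe, Multiset.cons_coe, Multiset.coe_eq_coe]
      exact List.perm_middle.trans (List.Perm.cons _ List.perm_middle)
    have hmer := merge (hN (g ::ₘ S) (by simp)).2.1 (hN (h ::ₘ T) (by simp)).2.1
    obtain ⟨s, hs⟩ := exists_HL _ hmer
    have hs1 := hs.pos (by simp)
    have hN' : HL N'.sum N'.card := ⟨N', rfl, fun A hA => hN A (by simp [hA]), rfl⟩
    have hM' : HL M'.sum M'.card := ⟨M', rfl, fun A hA => hM A (by simp [hA]), rfl⟩
    have hk := (HL.single hA).add hM'
    have hj := hs.add hN'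
    have heq : (g * h) ::ₘ (S + T) + N'.sum =
        ((p ++ (g * h) :: q : List G) : Multiset G) + M'.sum := by
      rw [Multiset.sum_cons, Multiset.sum_cons, Multiset.sum_cons, e2] at hsum
      have : g ::ₘ h ::ₘ (S + T + N'.sum) =
          g ::ₘ h ::ₘ (((p ++ q : List G) : Multiset G) + M'.sum) := by
        generalize ((p ++ q : List G) : Multiset G) = R at hsum
        simpa [Multiset.cons_add, Multiset.add_cons, add_assoc, Multiset.cons_swap] using hsum
      have := (Multiset.cons_inj_right _).1 ((Multiset.cons_inj_right _).1 this)
      rw [e1, Multiset.cons_add, Multiset.cons_add, this]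
    rw [heq] at hj
    simp only [Multiset.card_cons] at *
    have := ih _ ?_ _ rfl (1 + M'.card) l (s + N'.card) hk hj (by omega) (by omega)
    · rwa [add_comm] at this
    · rw [← hn]
      simp

lemma UL.interval {k l j : ℕ} (h : UL G k j) (h1 : k ≤ l) (h2 : l ≤ j) : UL G k l := by
  obtain ⟨a, ha, hb⟩ := h
  exact LV.interval a k l j ha hb h1 h2

lemma atom_pair {g : G} (hg : g ≠ 1) : IsMinimalProductOne ({g, g⁻¹} : Multiset G) := by
  refine ⟨by simp, ⟨[g, g⁻¹], rfl, by simp⟩, ?_⟩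
  intro S T hS hT pS pT he
  have hc := congrArg Multiset.card he
  have h1 := Multiset.card_pos.2 hS
  have h2 := Multiset.card_pos.2 hT
  simp at hc
  obtain ⟨x, rfl⟩ := Multiset.card_eq_one.1 (show S.card = 1 by omega)
  obtain ⟨l, hl, hlp⟩ := pS
  obtain rfl := Multiset.coe_eq_singleton.1 hl
  simp at hlp
  subst hlp
  have : (1 : G) ∈ ({g, g⁻¹} : Multiset G) := by
    rw [he]
    simp
  simp [hg.symm, eq_comm] at this
  exact hg (by simpa using this)

lemma bdd (hD : 0 < DavenportLarge G) :
    BddAbove {m | ∃ S : Multiset G, IsMinimalProductOne S ∧ Multiset.card S = m} := by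
  by_contra h
  have : DavenportLarge G = 0 := by
    unfold DavenportLarge
    exact Nat.sSup_of_not_bddAbove h
  omega

lemma card_le (hD : 0 < DavenportLarge G) {A : Multiset G} (hA : IsMinimalProductOne A) :
    A.card ≤ DavenportLarge G := le_csSup (bdd hD) ⟨A, hA, rfl⟩

lemma exists_max (hD : 0 < DavenportLarge G) :
    ∃ A : Multiset G, IsMinimalProductOne A ∧ A.card = DavenportLarge G :=
  Nat.sSup_mem (s := {m | ∃ S : Multiset G, IsMinimalProductOne S ∧ Multiset.card S = m})
    ⟨_, {1}, atom_one, rfl⟩ (bdd hD)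

lemma UL_two (hD : 2 ≤ DavenportLarge G) : UL G 2 (DavenportLarge G) := by
  obtain ⟨A, hA, hc⟩ := exists_max (G := G) (by omega)
  have h1 : (1 : G) ∉ A := by
    intro h
    rw [atom_one_mem hA h] at hc
    simp at hc
    omega
  -- inverse sequences
  have pinv : ∀ S : Multiset G, IsProductOne S → IsProductOne (S.map (·⁻¹)) := by
    rintro S ⟨l, rfl, hl⟩
    refine ⟨(l.map (·⁻¹)).reverse, by simp, ?_⟩
    rw [← List.prod_inv_reverse, hl, inv_one]
  have hA' : IsMinimalProductOne (A.map (·⁻¹)) := by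
    refine ⟨by simpa using hA.1, pinv _ hA.2.1, ?_⟩
    intro S T hS hT pS pT he
    refine hA.2.2 (S.map (·⁻¹)) (T.map (·⁻¹)) (by simpa using hS) (by simpa using hT)
      (pinv _ pS) (pinv _ pT) ?_
    rw [← Multiset.map_add, ← he]
    simp
  refine ⟨A + A.map (·⁻¹), (HL.single hA).add (HL.single hA'), A.map fun g => {g, g⁻¹},
    by simpa using hc, ?_, ?_⟩
  · intro B hB
    obtain ⟨g, hg, rfl⟩ := Multiset.mem_map.1 hB
    exact atom_pair (fun h => h1 (h ▸ hg))
  · clear hA hc h1 hA'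
    induction A using Multiset.induction with
    | empty => simp
    | cons a A ih =>
      rw [Multiset.map_cons, Multiset.sum_cons, ih, Multiset.map_cons]
      simp [Multiset.add_cons, Multiset.cons_add, Multiset.cons_swap]

lemma UL_bound (hD : 2 ≤ DavenportLarge G) {k m : ℕ} (h : UL G k m) :
    2 * k ≤ m * DavenportLarge G := by
  classical
  obtain ⟨a, ⟨M, rfl, hM, rfl⟩, N, rfl, hN, hsum⟩ := h
  have hatom : ∀ A : Multiset G, IsMinimalProductOne A →
      2 ≤ A.card + A.count 1 ∧ A.card + A.count 1 ≤ DavenportLarge G := by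
    intro A hA
    by_cases h1 : (1 : G) ∈ A
    · rw [atom_one_mem hA h1]
      simpa using hD
    · rw [Multiset.count_eq_zero_of_notMem h1]
      refine ⟨?_, by simpa using card_le (by omega) hA⟩
      have h0 := Multiset.card_pos.2 hA.1
      by_contra hlt
      obtain ⟨x, rfl⟩ := Multiset.card_eq_one.1 (show A.card = 1 by omega)
      obtain ⟨l, hl, hlp⟩ := hA.2.1
      obtain rfl := Multiset.coe_eq_singleton.1 hl
      simp at hlp
      simp [hlp] at h1
  have lo : 2 * M.card ≤ M.sum.card + M.sum.count 1 := by
    clear hsum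
    induction M using Multiset.induction with
    | empty => simp
    | cons A M ih =>
      have h1 := (hatom A (hM A (by simp))).1
      have h2 := ih fun B hB => hM B (by simp [hB])
      simp only [Multiset.card_cons, Multiset.sum_cons, Multiset.card_add, Multiset.count_add]
      omega
  have hi : N.sum.card + N.sum.count 1 ≤ N.card * DavenportLarge G := by
    clear hsum
    induction N using Multiset.induction with
    | empty => simp
    | cons A M ih =>
      have h1 := (hatom A (hN A (by simp))).2
      have h2 := ih fun B hB => hN B (by simp [hB])
      simp only [Multiset.card_cons, Multiset.sum_cons, Multiset.card_add, Multiset.count_add,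
        Nat.succ_mul]
      omega
  rw [hsum] at hi
  omega

lemma rho_bdd (hD : 2 ≤ DavenportLarge G) (k : ℕ) : BddAbove (UnionLengths G k) := by
  refine ⟨k * DavenportLarge G, ?_⟩
  intro m hm
  have := UL_bound hD ((mem_unionLengths k m).1 hm).symm
  omega

lemma lambda_eq {k m : ℕ} (h : UL G k m) (hmin : ∀ n, UL G k n → m ≤ n) : lambdaK G k = m := by
  unfold lambdaK
  refine le_antisymm (Nat.sInf_le ((mem_unionLengths k m).2 h)) ?_
  exact hmin _ ((mem_unionLengths _ _).1 (Nat.sInf_mem ⟨m, (mem_unionLengths k m).2 h⟩))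

end LV

open LV in
theorem lambda_values (G : Type*) [Group G] [Finite G] (hG : 3 ≤ Nat.card G)
    (l j : ℕ) (hj : j < DavenportLarge G) (h1 : 1 ≤ l * DavenportLarge G + j) :
    (j = 0 → lambdaK G (l * DavenportLarge G + j) = 2 * l) ∧
    (1 ≤ j → l * DavenportLarge G + j ≤ rhoK G (2 * l + 1) →
      lambdaK G (l * DavenportLarge G + j) = 2 * l + 1) ∧
    (rhoK G (2 * l + 1) < l * DavenportLarge G + j →
      lambdaK G (l * DavenportLarge G + j) = 2 * l + 2) := by
  have hD : 2 ≤ DavenportLarge G := by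
    have : Nontrivial G := Finite.one_lt_card_iff_nontrivial.1 (by omega)
    obtain ⟨g, hg⟩ := exists_ne (1 : G)
    simpa using card_le (by omega) (atom_pair hg)
  have hbase : UL G (2 * l) (l * DavenportLarge G) := by
    simpa [mul_comm] using (UL_two hD).mul l
  have hrho : ∀ m, UL G (2 * l + 1) m → m ≤ rhoK G (2 * l + 1) := fun m hm =>
    le_csSup (rho_bdd hD _) ((mem_unionLengths _ _).2 hm)
  have hlow : ∀ n, UL G (l * DavenportLarge G + j) n → 2 * l ≤ n ∧ (1 ≤ j → 2 * l + 1 ≤ n) := by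
    intro n hn
    have hb := UL_bound hD hn
    constructor
    · by_contra hlt
      have : n + 1 ≤ 2 * l := by omega
      have := Nat.mul_le_mul_right (DavenportLarge G) this
      nlinarith
    · intro hj1
      by_contra hlt
      have : n ≤ 2 * l := by omega
      have := Nat.mul_le_mul_right (DavenportLarge G) this
      nlinarith
  have h2l : l * 2 ≤ l * DavenportLarge G := Nat.mul_le_mul_left l hD
  refine ⟨?_, ?_, ?_⟩
  · rintro rfl
    exact lambda_eq hbase.symm fun n hn => (hlow n hn).1
  · intro hj1 hle
    refine lambda_eq ?_ fun n hn => (hlow n hn).2 hj1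
    have hm : UL G (2 * l + 1) (rhoK G (2 * l + 1)) := by
      refine (mem_unionLengths _ _).1 (Nat.sSup_mem ?_ (rho_bdd hD _))
      exact ⟨_, (mem_unionLengths _ _).2 (UL.refl _)⟩
    exact (hm.interval (by omega) hle).symm
  · intro hlt
    have h3 := hrho _ (hbase.add UL.one)
    have hj2 : 2 ≤ j := by omega
    refine lambda_eq ?_ ?_
    · exact (hbase.add ((UL_two hD).interval hj2 hj.le)).symm
    · intro n hn
      have h4 := (hlow n hn).2 (by omega)
      by_contra hcon
      obtain rfl : n = 2 * l + 1 := by omega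
      have := hrho _ hn.symm
      omega
end

section
/- Let G be a dihedral group of order 2n, where n ≥ 3 is odd. Then for every k ∈ ℕ with k ≥ 2, the union of sets of lengths U_k(G) is the discrete interval [λ_k(G), ρ_k(G)], and ρ_k(G) = k·n. -/
namespace DihedralLengths

/-- multiset version of `HasLength` -/
def Fact {G : Type*} [Group G] (a : Multiset G) (k : ℕ) : Prop :=
  ∃ F : Multiset (Multiset G), (∀ U ∈ F, IsMinimalProductOne U) ∧ F.sum = a ∧ Multiset.card F = k

theorem hasLength_iff {G : Type*} [Group G] (a : Multiset G) (k : ℕ) :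
    HasLength a k ↔ Fact a k := by
  constructor
  · rintro ⟨f, hf, hs⟩
    refine ⟨(Finset.univ : Finset (Fin k)).val.map f, ?_, hs, by simp⟩
    intro U hU
    rw [Multiset.mem_map] at hU
    obtain ⟨i, -, rfl⟩ := hU
    exact hf i
  · rintro ⟨F, hF, hs, hc⟩
    induction F using Quotient.inductionOn with
    | _ l =>
      have hl : l.length = k := by simpa using hc
      subst hl
      refine ⟨fun i => l.get i, fun i => hF _ (by simp), ?_⟩
      rw [← hs]
      simp [← List.sum_ofFn]

section General
variable {G : Type*} [Group G]

theorem productOne_add {S T : Multiset G} (hS : IsProductOne S) (hT : IsProductOne T) :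
    IsProductOne (S + T) := by
  obtain ⟨l, rfl, hl⟩ := hS
  obtain ⟨m, rfl, hm⟩ := hT
  exact ⟨l ++ m, by simp, by simp [hl, hm]⟩

theorem productOne_sum (F : Multiset (Multiset G)) (h : ∀ U ∈ F, IsMinimalProductOne U) :
    IsProductOne F.sum := by
  induction F using Multiset.induction_on with
  | empty => exact ⟨[], by simp, by simp⟩
  | cons U F ih =>
    rw [Multiset.sum_cons]
    exact productOne_add (h U (by simp)).2.1 (ih fun V hV => h V (by simp [hV]))

theorem mem_union_iff {k m : ℕ} :
    m ∈ UnionLengths G k ↔ ∃ a : Multiset G, Fact a k ∧ Fact a m := by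
  constructor
  · rintro ⟨a, -, h1, h2⟩
    exact ⟨a, (hasLength_iff _ _).1 h1, (hasLength_iff _ _).1 h2⟩
  · rintro ⟨a, h1, h2⟩
    refine ⟨a, ?_, (hasLength_iff _ _).2 h1, (hasLength_iff _ _).2 h2⟩
    obtain ⟨F, hF, rfl, -⟩ := h1
    exact productOne_sum F hF

theorem fact_add {a b : Multiset G} {k l : ℕ} (ha : Fact a k) (hb : Fact b l) :
    Fact (a + b) (k + l) := by
  obtain ⟨F, hF, rfl, rfl⟩ := ha
  obtain ⟨H, hH, rfl, rfl⟩ := hb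
  refine ⟨F + H, ?_, by simp, by simp⟩
  intro U hU
  rcases Multiset.mem_add.1 hU with h | h
  · exact hF U h
  · exact hH U h

theorem union_add {k l m p : ℕ} (h1 : m ∈ UnionLengths G k) (h2 : p ∈ UnionLengths G l) :
    m + p ∈ UnionLengths G (k + l) := by
  rw [mem_union_iff] at *
  obtain ⟨a, ha, ha'⟩ := h1
  obtain ⟨b, hb, hb'⟩ := h2
  exact ⟨a + b, fact_add ha hb, fact_add ha' hb'⟩

theorem union_symm {k m : ℕ} (h : m ∈ UnionLengths G k) : k ∈ UnionLengths G m := by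
  rw [mem_union_iff] at *
  obtain ⟨a, h1, h2⟩ := h
  exact ⟨a, h2, h1⟩

theorem fact_atom {U : Multiset G} (hU : IsMinimalProductOne U) : Fact U 1 :=
  ⟨{U}, by simpa using hU, by simp, by simp⟩

theorem atom_one : IsMinimalProductOne ({1} : Multiset G) := by
  refine ⟨by simp, ⟨[1], by simp, by simp⟩, ?_⟩
  intro T₁ T₂ h1 h2 _ _ h
  have := congrArg Multiset.card h
  have h1 := Multiset.card_pos.2 h1
  have h2 := Multiset.card_pos.2 h2
  simp at this
  omega

theorem eq_one_of_mem {U : Multiset G} (hU : IsMinimalProductOne U) (h : (1 : G) ∈ U) :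
    U = {1} := by
  classical
  obtain ⟨T, rfl⟩ := Multiset.exists_cons_of_mem h
  by_contra hne
  have hT : T ≠ 0 := by
    rintro rfl
    exact hne rfl
  refine hU.2.2 {1} T (by simp) hT atom_one.2.1 ?_ (by simp)
  obtain ⟨l, hl, hp⟩ := hU.2.1
  have h1 : (1 : G) ∈ l := by
    have : (1 : G) ∈ (l : Multiset G) := by rw [hl]; simp
    simpa using this
  obtain ⟨p, q, rfl⟩ := List.append_of_mem h1
  refine ⟨p ++ q, ?_, by simpa using hp⟩
  have h2 : ((p ++ 1 :: q : List G) : Multiset G) = 1 ::ₘ ((p ++ q : List G) : Multiset G) := by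
    rw [Multiset.cons_coe, Multiset.coe_eq_coe]
    exact List.perm_middle
  rw [h2] at hl
  exact (Multiset.cons_inj_right _).1 hl

theorem exists_fact (S : Multiset G) (hS : IsProductOne S) : ∃ t, Fact S t := by
  induction hc : Multiset.card S using Nat.strong_induction_on generalizing S with
  | _ N ih =>
    by_cases h0 : S = 0
    · subst h0
      exact ⟨0, 0, by simp, by simp, by simp⟩
    by_cases hm : IsMinimalProductOne S
    · exact ⟨1, fact_atom hm⟩
    · have : ∃ T₁ T₂ : Multiset G, T₁ ≠ 0 ∧ T₂ ≠ 0 ∧ IsProductOne T₁ ∧ IsProductOne T₂ ∧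
          S = T₁ + T₂ := by
        by_contra hcon
        refine hm ⟨h0, hS, fun T₁ T₂ a b c d e => hcon ⟨T₁, T₂, a, b, c, d, e⟩⟩
      obtain ⟨T₁, T₂, a, b, c, d, rfl⟩ := this
      have a' := Multiset.card_pos.2 a
      have b' := Multiset.card_pos.2 b
      rw [Multiset.card_add] at hc
      obtain ⟨t1, h1⟩ := ih _ (by omega) T₁ c rfl
      obtain ⟨t2, h2⟩ := ih _ (by omega) T₂ d rfl
      exact ⟨t1 + t2, fact_add h1 h2⟩

/-- rotate a product-one ordering -/
theorem productOne_cons {g : G} {X : Multiset G} (h : IsProductOne (g ::ₘ X)) :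
    ∃ l : List G, (l : Multiset G) = X ∧ g * l.prod = 1 := by
  obtain ⟨l, hl, hp⟩ := h
  have h1 : g ∈ l := by
    have : g ∈ (l : Multiset G) := by rw [hl]; simp
    simpa using this
  obtain ⟨p, q, rfl⟩ := List.append_of_mem h1
  refine ⟨q ++ p, ?_, ?_⟩
  · have h2 : ((p ++ g :: q : List G) : Multiset G) = g ::ₘ ((q ++ p : List G) : Multiset G) := by
      rw [Multiset.cons_coe, Multiset.coe_eq_coe]
      exact List.perm_middle.trans (List.Perm.cons _ List.perm_append_comm)
    rw [h2] at hl
    exact (Multiset.cons_inj_right _).1 hl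
  · simp only [List.prod_append, List.prod_cons] at hp ⊢
    rw [← mul_assoc]
    exact mul_eq_one_iff_eq_inv.2 (eq_inv_of_mul_eq_one_right hp)

theorem productOne_of_cons {g : G} {l : List G} (h : g * l.prod = 1) :
    IsProductOne (g ::ₘ (l : Multiset G)) := ⟨g :: l, by simp, by simpa using h⟩

/-- merging two adjacent terms of an atom gives an atom -/
theorem merge_atom {p q : List G} {g h : G}
    (hU : IsMinimalProductOne ((p ++ g :: h :: q : List G) : Multiset G))
    (hp : (p ++ g :: h :: q).prod = 1) :
    IsMinimalProductOne ((g * h) ::ₘ ((p ++ q : List G) : Multiset G)) := by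
  have e1 : ((p ++ g :: h :: q : List G) : Multiset G) =
      g ::ₘ h ::ₘ ((p ++ q : List G) : Multiset G) := by
    rw [Multiset.cons_coe, Multiset.cons_coe, Multiset.coe_eq_coe]
    exact List.perm_middle.trans (List.Perm.cons _ List.perm_middle)
  rw [e1] at hU
  have split : ∀ X : Multiset G, IsProductOne ((g * h) ::ₘ X) → IsProductOne (g ::ₘ h ::ₘ X) := by
    intro X hX
    obtain ⟨l, rfl, hl⟩ := productOne_cons hX
    exact ⟨g :: h :: l, by simp, by simpa [mul_assoc] using hl⟩
  refine ⟨by simp, ⟨p ++ (g * h) :: q, ?_, ?_⟩, ?_⟩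
  · rw [Multiset.cons_coe, Multiset.coe_eq_coe]
    exact List.perm_middle
  · simpa [mul_assoc] using hp
  · intro T₁ T₂ a b c d e
    have hmem : g * h ∈ T₁ + T₂ := by rw [← e]; simp
    rcases Multiset.mem_add.1 hmem with hm | hm
    · obtain ⟨X, rfl⟩ := Multiset.exists_cons_of_mem hm
      rw [Multiset.cons_add, Multiset.cons_inj_right] at e
      exact hU.2.2 _ T₂ (by simp) b (split X c) d (by rw [e]; simp)
    · obtain ⟨X, rfl⟩ := Multiset.exists_cons_of_mem hm
      rw [Multiset.add_cons, Multiset.cons_inj_right] at e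
      exact hU.2.2 T₁ _ a (by simp) c (split X d) (by rw [e]; simp)

theorem mem_sum {F : Multiset (Multiset G)} {g : G} : g ∈ F.sum ↔ ∃ U ∈ F, g ∈ U := by
  induction F using Multiset.induction_on with
  | empty => simp
  | cons U F ih => simp [ih]

/-- the chain argument -/
theorem chain_only {V : Multiset G} {H' : Multiset (Multiset G)} (l : List G)
    (hmem : ∀ x ∈ l, x ∈ (V ::ₘ H').sum)
    (hR : ∀ p q g h, l = p ++ g :: h :: q → g ∈ V → ∀ W ∈ H', h ∉ W)
    (g : G) (l' : List G) (hl : l = g :: l') (hg : g ∈ V) :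
    ∀ x ∈ l', x ∈ V ∧ ∀ W ∈ H', x ∉ W := by
  induction l' generalizing l g with
  | nil => simp
  | cons h t ih =>
    have h1 : ∀ W ∈ H', h ∉ W := hR [] t g h (by simpa using hl) hg
    have h2 : h ∈ V := by
      have := hmem h (by simp [hl])
      rw [mem_sum] at this
      obtain ⟨W, hW, hW'⟩ := this
      rcases Multiset.mem_cons.1 hW with rfl | hW
      · exact hW'
      · exact absurd hW' (h1 W hW)
    have h3 := ih (h :: t) (fun x hx => hmem x (by rw [hl]; exact List.mem_cons_of_mem _ hx))
      (fun p q a b hab => hR (g :: p) q a b (by rw [hl, hab]; simp)) h rfl h2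
    intro x hx
    rcases List.mem_cons.1 hx with rfl | hx
    · exact ⟨h2, h1⟩
    · exact h3 x hx

theorem exists_merge (F H : Multiset (Multiset G)) (hF : ∀ U ∈ F, IsMinimalProductOne U)
    (hH : ∀ U ∈ H, IsMinimalProductOne U) (hs : F.sum = H.sum)
    (hc : Multiset.card F < Multiset.card H) (h1 : ({1} : Multiset G) ∉ F) :
    ∃ (p q : List G) (g h : G) (V W : Multiset G) (H' : Multiset (Multiset G)),
      ((p ++ g :: h :: q : List G) : Multiset G) ∈ F ∧ (p ++ g :: h :: q).prod = 1 ∧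
      H = V ::ₘ W ::ₘ H' ∧ g ∈ V ∧ h ∈ W := by
  classical
  by_contra hcon
  have key : ∀ U ∈ F, ∃ V, ∀ W ∈ H, (∃ x ∈ U, x ∈ W) → W = V ∧ V ∉ H.erase V := by
    intro U hU
    obtain ⟨l, rfl, hl⟩ := (hF U hU).2.1
    have hmemH : ∀ x ∈ l, x ∈ H.sum := by
      intro x hx
      rw [← hs, mem_sum]
      exact ⟨_, hU, by simpa using hx⟩
    match l, hl, hU, hmemH with
    | [], _, hU, _ => exact absurd rfl (hF _ hU).1
    | [a], hl, hU, _ =>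
      simp at hl
      subst hl
      exact absurd hU h1
    | a :: b :: t, hl, hU, hmemH =>
      obtain ⟨V, hV, haV⟩ := mem_sum.1 (hmemH a (by simp))
      obtain ⟨H', rfl⟩ := Multiset.exists_cons_of_mem hV
      have hall := chain_only (a :: b :: t) hmemH (by
        intro p q g h hpq hg W hW hh
        obtain ⟨H'', rfl⟩ := Multiset.exists_cons_of_mem hW
        exact hcon ⟨p, q, g, h, V, W, H'', by rw [← hpq]; exact hU, by rw [← hpq]; exact hl,
          rfl, hg, hh⟩) a (b :: t) rfl haV
      have hb := hall b (by simp)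
      have ha : ∀ W ∈ H', a ∉ W := by
        intro W hW haW
        obtain ⟨H'', rfl⟩ := Multiset.exists_cons_of_mem hW
        exact hcon ⟨[], t, a, b, W, V, H'', hU, hl, Multiset.cons_swap _ _ _, haW, hb.1⟩
      have hno : ∀ x ∈ (a :: b :: t), ∀ W ∈ H', x ∉ W := by
        intro x hx
        rcases List.mem_cons.1 hx with rfl | hx
        · exact ha
        · exact (hall x hx).2
      refine ⟨V, ?_⟩
      rintro W hW ⟨x, hx, hxW⟩
      refine ⟨?_, ?_⟩
      · rcases Multiset.mem_cons.1 hW with h | h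
        · exact h
        · exact absurd hxW (hno x (by simpa using hx) W h)
      · rw [Multiset.erase_cons_head]
        exact fun hV' => ha V hV' haV
  choose! φ hφ using key
  have hall : ∀ W ∈ H, ∃ U ∈ F, W = φ U ∧ φ U ∉ H.erase (φ U) := by
    intro W hW
    obtain ⟨x, hx⟩ := Multiset.exists_mem_of_ne_zero (hH W hW).1
    have : x ∈ F.sum := by rw [hs, mem_sum]; exact ⟨W, hW, hx⟩
    obtain ⟨U, hU, hxU⟩ := mem_sum.1 this
    exact ⟨U, hU, hφ U hU W hW ⟨x, hxU, hx⟩⟩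
  have hnd : H.Nodup := by
    rw [Multiset.nodup_iff_count_le_one]
    intro W
    by_cases hW : W ∈ H
    · obtain ⟨U, hU, rfl, h⟩ := hall W hW
      have := Multiset.count_eq_zero.2 h
      rw [Multiset.count_erase_self] at this
      omega
    · rw [Multiset.count_eq_zero.2 hW]; omega
  have hle : H ≤ F.map φ := by
    rw [Multiset.le_iff_subset hnd]
    intro W hW
    obtain ⟨U, hU, h, -⟩ := hall W hW
    exact Multiset.mem_map.2 ⟨U, hU, h.symm⟩
  have := Multiset.card_le_card hle
  rw [Multiset.card_map] at this
  omega

theorem one_mem_union : 1 ∈ UnionLengths G 1 :=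
  mem_union_iff.2 ⟨{1}, fact_atom atom_one, fact_atom atom_one⟩

theorem interval_aux (N : ℕ) : ∀ (a : Multiset G) (k l j : ℕ), Multiset.card a = N →
    Fact a k → Fact a j → k ≤ l → l ≤ j → l ∈ UnionLengths G k := by
  classical
  induction N using Nat.strong_induction_on with
  | _ N ih =>
    intro a k l j hN hk hj hkl hlj
    rcases hlj.eq_or_lt with rfl | hlj
    · exact mem_union_iff.2 ⟨a, hk, hj⟩
    obtain ⟨F, hF, hFs, hFc⟩ := hk
    obtain ⟨H, hH, hHs, hHc⟩ := hj
    by_cases h1 : ({1} : Multiset G) ∈ F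
    · have hmem : (1 : G) ∈ H.sum := by
        rw [hHs, ← hFs, mem_sum]
        exact ⟨_, h1, by simp⟩
      obtain ⟨V, hV, h1V⟩ := mem_sum.1 hmem
      have hV1 := eq_one_of_mem (hH V hV) h1V
      subst hV1
      obtain ⟨F', rfl⟩ := Multiset.exists_cons_of_mem h1
      obtain ⟨H', rfl⟩ := Multiset.exists_cons_of_mem hV
      rw [Multiset.sum_cons] at hFs hHs
      rw [Multiset.card_cons] at hFc hHc
      have hE : F'.sum = H'.sum := by
        have := hFs.trans hHs.symm
        exact add_left_cancel this
      have hcard : Multiset.card F'.sum < N := by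
        rw [← hN, ← hFs]; simp
      have := ih _ hcard F'.sum (Multiset.card F') (l - 1) (Multiset.card H') rfl
        ⟨F', fun U hU => hF U (by simp [hU]), rfl, rfl⟩
        ⟨H', fun U hU => hH U (by simp [hU]), hE.symm, rfl⟩ (by omega) (by omega)
      have h2 := union_add this one_mem_union
      have e1 : l - 1 + 1 = l := by omega
      rw [e1, hFc] at h2
      exact h2
    · obtain ⟨p, q, g, h, V, W, H', hU, hp, rfl, hg, hh⟩ :=
        exists_merge F H hF hH (hFs.trans hHs.symm) (by omega) h1
      obtain ⟨F', rfl⟩ := Multiset.exists_cons_of_mem hU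
      have hV := hH V (by simp)
      have hW := hH W (by simp)
      obtain ⟨X, rfl⟩ := Multiset.exists_cons_of_mem hg
      obtain ⟨Y, rfl⟩ := Multiset.exists_cons_of_mem hh
      have e1 : ((p ++ g :: h :: q : List G) : Multiset G) =
          g ::ₘ h ::ₘ ((p ++ q : List G) : Multiset G) := by
        rw [Multiset.cons_coe, Multiset.cons_coe, Multiset.coe_eq_coe]
        exact List.perm_middle.trans (List.Perm.cons _ List.perm_middle)
      have hat := merge_atom (hF _ (by simp)) hp
      have hVW : IsProductOne ((g * h) ::ₘ (Y + X)) := by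
        obtain ⟨lx, rfl, hlx⟩ := productOne_cons hV.2.1
        obtain ⟨ly, rfl, hly⟩ := productOne_cons hW.2.1
        rw [Multiset.coe_add]
        apply productOne_of_cons
        rw [List.prod_append]
        calc g * h * (ly.prod * lx.prod) = g * (h * ly.prod) * lx.prod := by group
          _ = 1 := by rw [hly, mul_one, hlx]
      obtain ⟨t, ht⟩ := exists_fact _ hVW
      have ht1 : 1 ≤ t := by
        rcases Nat.eq_zero_or_pos t with rfl | h
        · obtain ⟨E, -, hE, hE0⟩ := ht
          rw [Multiset.card_eq_zero] at hE0
          subst hE0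
          have := congrArg Multiset.card hE
          simp at this
        · exact h
      rw [Multiset.sum_cons, e1] at hFs
      rw [Multiset.sum_cons, Multiset.sum_cons] at hHs
      rw [Multiset.card_cons] at hFc
      rw [Multiset.card_cons, Multiset.card_cons] at hHc
      have hE : ((p ++ q : List G) : Multiset G) + F'.sum = (Y + X) + H'.sum := by
        have h2 := hFs.trans hHs.symm
        have h3 : g ::ₘ h ::ₘ (((p ++ q : List G) : Multiset G) + F'.sum) =
            g ::ₘ h ::ₘ ((Y + X) + H'.sum) := by
          rw [← Multiset.cons_add, ← Multiset.cons_add, h2]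
          simp only [← Multiset.singleton_add]
          abel
        exact (Multiset.cons_inj_right _).1 ((Multiset.cons_inj_right _).1 h3)
      have f1 : Fact ((g * h) ::ₘ ((p ++ q : List G) : Multiset G) + F'.sum)
          (1 + Multiset.card F') :=
        fact_add (fact_atom hat) ⟨F', fun U hU => hF U (by simp [hU]), rfl, rfl⟩
      have f2 : Fact ((g * h) ::ₘ (Y + X) + H'.sum) (t + Multiset.card H') :=
        fact_add ht ⟨H', fun U hU => hH U (by simp [hU]), rfl, rfl⟩
      rw [Multiset.cons_add, ← hE, ← Multiset.cons_add] at f2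
      have hcard : Multiset.card ((g * h) ::ₘ ((p ++ q : List G) : Multiset G) + F'.sum) < N := by
        rw [← hN, ← hFs]; simp
      have := ih _ hcard _ _ l _ rfl f1 f2 (by omega) (by omega)
      rwa [add_comm, hFc] at this

theorem interval {k l j : ℕ} (hj : j ∈ UnionLengths G k) (hkl : k ≤ l) (hlj : l ≤ j) :
    l ∈ UnionLengths G k := by
  obtain ⟨a, h1, h2⟩ := mem_union_iff.1 hj
  exact interval_aux _ a k l j rfl h1 h2 hkl hlj

theorem card_atom_le [Finite G] {U : Multiset G} (hU : IsMinimalProductOne U) :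
    Multiset.card U ≤ Nat.card G := by
  obtain ⟨l, rfl, hl⟩ := hU.2.1
  have key : ∀ i j : ℕ, i < j → j < l.length → (l.take i).prod ≠ (l.take j).prod := by
    intro i j hij hj he
    have e1 : l.take j = l.take i ++ (l.take j).drop i := by
      conv_lhs => rw [← List.take_append_drop i (l.take j)]
      rw [List.take_take, min_eq_left hij.le]
    have hmid : ((l.take j).drop i).prod = 1 := by
      rw [e1, List.prod_append] at he
      exact (mul_eq_left.1 he.symm)
    have hrest : (l.take i ++ l.drop j).prod = 1 := by
      rw [List.prod_append, he, ← List.prod_append, List.take_append_drop, hl]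
    refine hU.2.2 (((l.take j).drop i : List G) : Multiset G)
      ((l.take i ++ l.drop j : List G) : Multiset G) ?_ ?_ ⟨_, rfl, hmid⟩ ⟨_, rfl, hrest⟩ ?_
    · rw [← Multiset.card_pos]; simp; omega
    · rw [← Multiset.card_pos]; simp; omega
    · conv_lhs => rw [← List.take_append_drop j l, e1]
      simp only [← Multiset.coe_add]
      abel
  have hinj : Function.Injective (fun i : Fin l.length => (l.take i).prod) := by
    intro i j hij
    rcases lt_trichotomy i j with h | h | h
    · exact absurd hij (key i j h j.2)
    · exact h
    · exact absurd hij.symm (key j i h i.2)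
  have := Nat.card_le_card_of_injective _ hinj
  simpa using this

theorem upper [Finite G] {N k m : ℕ} (hN : 1 ≤ N) (hG : Nat.card G = 2 * N)
    (h : m ∈ UnionLengths G k) : m ≤ k * N := by
  classical
  obtain ⟨a, ⟨F, hF, hFs, rfl⟩, ⟨H, hH, hHs, rfl⟩⟩ := mem_union_iff.1 h
  have lo : ∀ U : Multiset G, IsMinimalProductOne U →
      2 ≤ Multiset.card U + U.count 1 ∧ Multiset.card U + U.count 1 ≤ 2 * N := by
    intro U hU
    by_cases h1 : (1 : G) ∈ U
    · rw [eq_one_of_mem hU h1]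
      simp; omega
    · rw [Multiset.count_eq_zero.2 h1]
      have h2 := card_atom_le hU
      have h3 := Multiset.card_pos.2 hU.1
      have h4 : Multiset.card U ≠ 1 := by
        intro h4
        obtain ⟨x, rfl⟩ := Multiset.card_eq_one.1 h4
        obtain ⟨l, hl, hp⟩ := hU.2.1
        rw [Multiset.coe_eq_singleton] at hl
        subst hl
        simp at hp
        subst hp
        simp at h1
      omega
  have A : ∀ E : Multiset (Multiset G), (∀ U ∈ E, IsMinimalProductOne U) →
      2 * Multiset.card E ≤ Multiset.card E.sum + E.sum.count 1 ∧
      Multiset.card E.sum + E.sum.count 1 ≤ 2 * N * Multiset.card E := by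
    intro E
    induction E using Multiset.induction_on with
    | empty => simp
    | cons U E ih =>
      intro hE
      have h1 := ih fun V hV => hE V (by simp [hV])
      have h2 := lo U (hE U (by simp))
      rw [Multiset.sum_cons, Multiset.card_add, Multiset.count_add, Multiset.card_cons, mul_add,
        mul_add]
      omega
  have h1 := (A F hF).2
  have h2 := (A H hH).1
  rw [hFs] at h1
  rw [hHs] at h2
  nlinarith

theorem two_le_of_mem {k m : ℕ} (hk : 2 ≤ k) (h : m ∈ UnionLengths G k) : 2 ≤ m := by
  obtain ⟨a, ⟨F, hF, hFs, rfl⟩, ⟨H, hH, hHs, rfl⟩⟩ := mem_union_iff.1 h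
  by_contra hlt
  obtain ⟨U, F', rfl⟩ : ∃ U F', F = U ::ₘ F' := by
    obtain ⟨U, hU⟩ := Multiset.exists_mem_of_ne_zero (s := F) (by rintro rfl; simp at hk)
    exact ⟨U, Multiset.exists_cons_of_mem hU⟩
  obtain ⟨V, F', rfl⟩ : ∃ V F'', F' = V ::ₘ F'' := by
    obtain ⟨U, hU⟩ := Multiset.exists_mem_of_ne_zero (s := F') (by rintro rfl; simp at hk)
    exact ⟨U, Multiset.exists_cons_of_mem hU⟩
  have hU := hF U (by simp)
  have hV := hF V (by simp)
  rw [Multiset.sum_cons] at hFs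
  have hne : (V ::ₘ F').sum ≠ 0 := by
    rw [Multiset.sum_cons]
    have := Multiset.card_pos.2 hV.1
    rw [← Multiset.card_pos, Multiset.card_add]
    omega
  have hc : Multiset.card H = 0 ∨ Multiset.card H = 1 := by omega
  rcases hc with hc | hc
  · rw [Multiset.card_eq_zero] at hc
    subst hc
    have := Multiset.card_pos.2 hU.1
    rw [← hHs] at hFs
    have := congrArg Multiset.card hFs
    rw [Multiset.card_add] at this
    simp at this
    exact hU.1 this.1
  · obtain ⟨Z, rfl⟩ := Multiset.card_eq_one.1 hc
    rw [Multiset.sum_singleton] at hHs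
    subst hHs
    exact (hH Z (by simp)).2.2 U _ hU.1 hne hU.2.1
      (productOne_sum _ fun W hW => hF W (Multiset.mem_cons_of_mem hW)) hFs.symm

end General

section Transport
variable {G K : Type*} [Group G] [Group K]

theorem productOne_map (e : G ≃* K) {S : Multiset G} (h : IsProductOne S) :
    IsProductOne (S.map e) := by
  obtain ⟨l, rfl, hl⟩ := h
  refine ⟨l.map e, by simp, ?_⟩
  have := map_list_prod e l
  rw [← this, hl, map_one]

theorem atom_map (e : G ≃* K) {S : Multiset G} (h : IsMinimalProductOne S) :
    IsMinimalProductOne (S.map e) := by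
  refine ⟨by simpa using h.1, productOne_map e h.2.1, ?_⟩
  intro T₁ T₂ a b c d hE
  refine h.2.2 (T₁.map e.symm) (T₂.map e.symm) (by simpa using a) (by simpa using b)
    (productOne_map e.symm c) (productOne_map e.symm d) ?_
  rw [← Multiset.map_add, ← hE, Multiset.map_map]
  simp

theorem fact_map (e : G ≃* K) {a : Multiset G} {k : ℕ} (h : Fact a k) : Fact (a.map e) k := by
  obtain ⟨F, hF, rfl, rfl⟩ := h
  refine ⟨F.map (Multiset.map e), ?_, ?_, by simp⟩
  · intro U hU
    obtain ⟨V, hV, rfl⟩ := Multiset.mem_map.1 hU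
    exact atom_map e (hF V hV)
  · exact (map_multiset_sum (Multiset.mapAddMonoidHom e) F).symm

theorem union_map (e : G ≃* K) {k m : ℕ} (h : m ∈ UnionLengths G k) : m ∈ UnionLengths K k := by
  obtain ⟨a, h1, h2⟩ := mem_union_iff.1 h
  exact mem_union_iff.2 ⟨_, fact_map e h1, fact_map e h2⟩

end Transport

section Dihedral
open DihedralGroup
variable {n : ℕ}

theorem list_prod_form (i d : ZMod n) (l : List (DihedralGroup n))
    (hl : ∀ x ∈ l, x = sr i ∨ x = sr (i + d)) (hd : i ≠ i + d) :
    ∃ c : ℤ, |c| ≤ l.count (sr (i + d)) ∧ (2 : ℤ) ∣ (l.count (sr (i + d)) : ℤ) - c ∧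
      ((l.prod = r ((c : ZMod n) * d) ∧ Even l.length) ∨ (l.prod = sr (i + (c : ZMod n) * d) ∧ Odd l.length)) := by
  induction l with
  | nil => exact ⟨0, by simp, by simp, Or.inl ⟨by simp, by simp⟩⟩
  | cons x l ih =>
    obtain ⟨c, h1, h2, h3⟩ := ih fun y hy => hl y (by simp [hy])
    have hne : (sr i : DihedralGroup n) ≠ sr (i + d) := by
      intro h
      exact hd (by simpa using h)
    rcases hl x (by simp) with rfl | rfl
    · refine ⟨c, by rwa [List.count_cons_of_ne hne], by rwa [List.count_cons_of_ne hne], ?_⟩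
      rcases h3 with ⟨h3, h4⟩ | ⟨h3, h4⟩
      · right
        refine ⟨by rw [List.prod_cons, h3, sr_mul_r], ?_⟩
        rw [List.length_cons]; exact h4.add_one
      · left
        refine ⟨by rw [List.prod_cons, h3, sr_mul_sr]; congr 1; ring, ?_⟩
        rw [List.length_cons]; exact h4.add_one
    · rw [List.count_cons_self]
      rw [abs_le] at h1
      rcases h3 with ⟨h3, h4⟩ | ⟨h3, h4⟩
      · refine ⟨c + 1, by rw [abs_le]; push_cast; omega, by push_cast; omega, Or.inr ⟨?_, ?_⟩⟩
        · rw [List.prod_cons, h3, sr_mul_r]; congr 1; push_cast; ring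
        · rw [List.length_cons]; exact h4.add_one
      · refine ⟨c - 1, by rw [abs_le]; push_cast; omega, by push_cast; omega, Or.inl ⟨?_, ?_⟩⟩
        · rw [List.prod_cons, h3, sr_mul_sr]; congr 1; push_cast; ring
        · rw [List.length_cons]; exact h4.add_one

theorem count_cond (i d : ZMod n) (hreg : ∀ c : ℤ, (c : ZMod n) * d = 0 → (n : ℤ) ∣ c)
    (hd : i ≠ i + d) (T : Multiset (DihedralGroup n))
    (hT : ∀ x ∈ T, x = sr i ∨ x = sr (i + d)) (h : IsProductOne T) :
    Even (Multiset.card T) ∧ (Odd (T.count (sr (i + d))) → n ≤ T.count (sr (i + d))) := by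
  obtain ⟨l, rfl, hl⟩ := h
  obtain ⟨c, h1, h2, h3⟩ := list_prod_form i d l (by simpa using hT) hd
  rw [hl] at h3
  rcases h3 with ⟨h3, h4⟩ | ⟨h3, h4⟩
  · refine ⟨by simpa using h4, ?_⟩
    rw [Multiset.coe_count]
    rintro ⟨t, ht⟩
    rw [one_def, r.injEq] at h3
    have h5 := hreg c h3.symm
    have hc : c ≠ 0 := by
      rintro rfl
      omega
    have h6 := Int.le_of_dvd (abs_pos.2 hc) ((dvd_abs _ _).2 h5)
    omega
  · rw [one_def] at h3
    cases h3

theorem atom_dihedral (hodd : Odd n) (i d : ZMod n)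
    (hreg : ∀ c : ℤ, (c : ZMod n) * d = 0 → (n : ℤ) ∣ c) (hd : i ≠ i + d) :
    IsMinimalProductOne (Multiset.replicate n (sr i : DihedralGroup n) +
      Multiset.replicate n (sr (i + d))) := by
  have hne : (sr i : DihedralGroup n) ≠ sr (i + d) := by
    intro h
    exact hd (by simpa using h)
  have hn0 : 0 < n := hodd.pos
  refine ⟨?_, ?_, ?_⟩
  · rw [← Multiset.card_pos]; simp; omega
  · have : ∀ m : ℕ, ∃ l : List (DihedralGroup n), (l : Multiset (DihedralGroup n)) =
        Multiset.replicate m (sr i) + Multiset.replicate m (sr (i + d)) ∧ l.prod = r ((m : ZMod n) * d) := by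
      intro m
      induction m with
      | zero => exact ⟨[], by simp, by simp⟩
      | succ m ih =>
        obtain ⟨l, h1, h2⟩ := ih
        refine ⟨sr i :: sr (i + d) :: l, ?_, ?_⟩
        · rw [← Multiset.cons_coe, ← Multiset.cons_coe, h1, Multiset.replicate_succ,
            Multiset.replicate_succ]
          simp only [← Multiset.singleton_add]
          abel
        · rw [List.prod_cons, List.prod_cons, h2, sr_mul_r, sr_mul_sr]
          congr 1; push_cast; ring
    obtain ⟨l, h1, h2⟩ := this n
    exact ⟨l, h1, by simpa using h2⟩
  · intro T₁ T₂ h1 h2 p1 p2 hE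
    have hmem : ∀ x ∈ T₁ + T₂, x = sr i ∨ x = sr (i + d) := by
      rw [← hE]
      intro x hx
      rcases Multiset.mem_add.1 hx with hx | hx
      · exact Or.inl (Multiset.eq_of_mem_replicate hx)
      · exact Or.inr (Multiset.eq_of_mem_replicate hx)
    have hca : T₁.count (sr i) + T₂.count (sr i) = n := by
      rw [← Multiset.count_add, ← hE]
      simp [Multiset.count_replicate, hne.symm]
    have hcb : T₁.count (sr (i + d)) + T₂.count (sr (i + d)) = n := by
      rw [← Multiset.count_add, ← hE]
      simp [Multiset.count_replicate, hne]
    have main : ∀ T : Multiset (DihedralGroup n), IsProductOne T →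
        (∀ x ∈ T, x = sr i ∨ x = sr (i + d)) →
        Multiset.card T = T.count (sr i) + T.count (sr (i + d)) ∧ Even (Multiset.card T) ∧
        (Odd (T.count (sr (i + d))) → n ≤ T.count (sr (i + d))) ∧
        (Odd (T.count (sr i)) → n ≤ T.count (sr i)) := by
      intro T hT hx
      have q1 := count_cond i d hreg hd T hx hT
      have q2 := count_cond (i + d) (-d)
        (fun c hc => hreg c (by rw [mul_neg, neg_eq_zero] at hc; exact hc))
        (by rw [add_neg_cancel_right]; exact hd.symm) T
        (by rw [add_neg_cancel_right]; exact fun x h => (hx x h).symm) hT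
      rw [add_neg_cancel_right] at q2
      refine ⟨?_, q1.1, q1.2, q2.2⟩
      clear q1 q2 hT
      induction T using Multiset.induction_on with
      | empty => simp
      | cons x T ih =>
        have := ih fun y hy => hx y (by simp [hy])
        rcases hx x (by simp) with rfl | rfl
        · rw [Multiset.count_cons_self, Multiset.count_cons_of_ne hne.symm, Multiset.card_cons]
          omega
        · rw [Multiset.count_cons_self, Multiset.count_cons_of_ne hne, Multiset.card_cons]
          omega
    obtain ⟨a1, a2, a3, a4⟩ := main T₁ p1 fun x hx => hmem x (Multiset.mem_add.2 (Or.inl hx))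
    obtain ⟨b1, b2, b3, b4⟩ := main T₂ p2 fun x hx => hmem x (Multiset.mem_add.2 (Or.inr hx))
    have h1 := Multiset.card_pos.2 h1
    have h2 := Multiset.card_pos.2 h2
    rw [Nat.even_iff] at a2 b2
    rw [Nat.odd_iff] at a3 a4 b3 b4 hodd
    omega

theorem atom_sq (i : ZMod n) : IsMinimalProductOne ({sr i, sr i} : Multiset (DihedralGroup n)) := by
  refine ⟨by simp, ⟨[sr i, sr i], rfl, by simp⟩, ?_⟩
  intro T₁ T₂ h1 h2 p1 p2 hE
  have h1 := Multiset.card_pos.2 h1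
  have h2 := Multiset.card_pos.2 h2
  have hc := congrArg Multiset.card hE
  rw [Multiset.card_add] at hc
  simp at hc
  obtain ⟨x, rfl⟩ := Multiset.card_eq_one.1 (by omega : Multiset.card T₁ = 1)
  have hx : x ∈ ({sr i, sr i} : Multiset (DihedralGroup n)) := by rw [hE]; simp
  have hx' : x = sr i := by simpa using hx
  subst hx'
  obtain ⟨l, hl, hp⟩ := p1
  rw [Multiset.coe_eq_singleton] at hl
  subst hl
  simp [one_def, -r_zero] at hp

theorem fact_sq (i : ZMod n) (m : ℕ) :
    Fact (Multiset.replicate m (sr i : DihedralGroup n) + Multiset.replicate m (sr i)) m := by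
  refine ⟨Multiset.replicate m {sr i, sr i}, ?_, ?_, by simp⟩
  · intro U hU
    rw [Multiset.eq_of_mem_replicate hU]
    exact atom_sq i
  · rw [Multiset.sum_replicate]
    induction m with
    | zero => simp
    | succ m ih =>
      rw [succ_nsmul, ih, Multiset.replicate_succ]
      simp only [← Multiset.singleton_add, Multiset.insert_eq_cons]
      abel

theorem lower (hn : 3 ≤ n) (hodd : Odd n) (k : ℕ) (hk : 2 ≤ k) :
    k * n ∈ UnionLengths (DihedralGroup n) k := by
  have r1 : ∀ c : ℤ, (c : ZMod n) * 1 = 0 → (n : ℤ) ∣ c := by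
    intro c hc
    rw [mul_one] at hc
    exact (ZMod.intCast_zmod_eq_zero_iff_dvd c n).1 hc
  have r2 : ∀ c : ℤ, (c : ZMod n) * (1 + 1) = 0 → (n : ℤ) ∣ c := by
    intro c hc
    have h : ((c * 2 : ℤ) : ZMod n) = 0 := by
      rw [← hc]; push_cast; ring
    have h2 := (ZMod.intCast_zmod_eq_zero_iff_dvd _ n).1 h
    refine IsCoprime.dvd_of_dvd_mul_right ?_ h2
    obtain ⟨t, rfl⟩ := hodd
    exact ⟨1, -t, by push_cast; ring⟩
  have ne_of : ∀ i d : ZMod n, (∀ c : ℤ, (c : ZMod n) * d = 0 → (n : ℤ) ∣ c) → i ≠ i + d := by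
    intro i d h hid
    have hd : d = 0 := by simpa using hid.symm
    have := h 1 (by simp [hd])
    have := Int.le_of_dvd (by norm_num) this
    omega
  have A01 := fact_atom (atom_dihedral hodd (0 : ZMod n) 1 r1 (ne_of _ _ r1))
  have A02 := fact_atom (atom_dihedral hodd (0 : ZMod n) (1 + 1) r2 (ne_of _ _ r2))
  have A12 := fact_atom (atom_dihedral hodd (0 + 1 : ZMod n) 1 r1 (ne_of _ _ r1))
  rw [add_assoc (0 : ZMod n) 1 1] at A12
  have two : 2 * n ∈ UnionLengths (DihedralGroup n) 2 := by
    refine mem_union_iff.2 ⟨_, fact_add A01 A01, ?_⟩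
    have := fact_add (fact_sq (0 : ZMod n) n) (fact_sq (0 + 1 : ZMod n) n)
    rw [← two_mul] at this
    convert this using 1
    abel
  have three : 3 * n ∈ UnionLengths (DihedralGroup n) 3 := by
    refine mem_union_iff.2 ⟨_, fact_add (fact_add A01 A12) A02, ?_⟩
    have := fact_add (fact_add (fact_sq (0 : ZMod n) n) (fact_sq (0 + 1 : ZMod n) n))
      (fact_sq (0 + (1 + 1) : ZMod n) n)
    have e : n + n + n = 3 * n := by ring
    rw [e] at this
    convert this using 1
    abel
  induction k using Nat.strong_induction_on with
  | _ k ih =>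
    rcases (by omega : k = 2 ∨ k = 3 ∨ 4 ≤ k) with rfl | rfl | h4
    · exact two
    · exact three
    · obtain ⟨j, rfl⟩ : ∃ j, k = j + 2 := ⟨k - 2, by omega⟩
      have := union_add (ih j (by omega) (by omega)) two
      rwa [← add_mul] at this

end Dihedral

end DihedralLengths

theorem unions_of_sets_of_lengths_dihedral_odd
    (n : ℕ) (hn : 3 ≤ n) (hodd : Odd n)
    (G : Type*) [Group G] (hG : Nonempty (G ≃* DihedralGroup n))
    (k : ℕ) (hk : 2 ≤ k) :
    UnionLengths G k = Set.Icc (lambdaK G k) (rhoK G k) ∧ rhoK G k = k * n := by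
  obtain ⟨e⟩ := hG
  haveI : NeZero n := ⟨by omega⟩
  haveI : Finite G := Finite.of_equiv _ e.symm.toEquiv
  have hcard : Nat.card G = 2 * n := by
    rw [Nat.card_congr e.toEquiv, DihedralGroup.nat_card]
  have hup : ∀ {k m : ℕ}, m ∈ UnionLengths G k → m ≤ k * n :=
    fun h => DihedralLengths.upper (by omega) hcard h
  have hlow : ∀ k, 2 ≤ k → k * n ∈ UnionLengths G k :=
    fun k hk => DihedralLengths.union_map e.symm (DihedralLengths.lower hn hodd k hk)
  have hrho : rhoK G k = k * n :=
    IsGreatest.csSup_eq ⟨hlow k hk, fun m hm => hup hm⟩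
  refine ⟨?_, hrho⟩
  have hmin : lambdaK G k ∈ UnionLengths G k := Nat.sInf_mem ⟨_, hlow k hk⟩
  apply Set.Subset.antisymm
  · intro m hm
    exact ⟨Nat.sInf_le hm, by rw [hrho]; exact hup hm⟩
  · rintro m ⟨h1, h2⟩
    rw [hrho] at h2
    rcases le_total k m with h | h
    · exact DihedralLengths.interval (hlow k hk) h h2
    · have h3 := DihedralLengths.two_le_of_mem hk hmin
      have h4 := hup (DihedralLengths.union_symm hmin)
      have h5 : lambdaK G k * n ≤ m * n := Nat.mul_le_mul_right n h1
      exact DihedralLengths.union_symm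
        (DihedralLengths.interval (hlow m (by omega)) h (by omega))
end

section
/- Let G be a dihedral group of order 2n, where n ≥ 3 is odd, and let l ∈ ℕ_0 and j ∈ [0, 2n - 1] be such that 2ln + j ≥ 1. Then λ_{2ln+j}(G) = 2l + j if j ∈ [0, 1]; λ_{2ln+j}(G) = 2 if j ≥ 2 and l = 0; λ_{2ln+j}(G) = 2l + 1 if j ∈ [2, n] and l ≥ 1; and λ_{2ln+j}(G) = 2l + 2 if j ∈ [n+1, 2n-1] and l ≥ 1. -/
section Generic
variable {G : Type*} [Group G]

theorem IsProductOne.add' {S T : Multiset G} (hS : IsProductOne S) (hT : IsProductOne T) :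
    IsProductOne (S + T) := by
  obtain ⟨l, rfl, h⟩ := hS
  obtain ⟨l', rfl, h'⟩ := hT
  exact ⟨l ++ l', by simp, by simp [h, h']⟩

theorem IsProductOne.zero' : IsProductOne (0 : Multiset G) := ⟨[], by simp, by simp⟩

theorem HasLength.zero' : HasLength (0 : Multiset G) 0 :=
  ⟨fun _ => 0, fun i => i.elim0, by simp⟩

theorem HasLength.of_atom {S : Multiset G} (h : IsMinimalProductOne S) : HasLength S 1 :=
  ⟨fun _ => S, fun _ => h, by simp⟩

theorem HasLength.add' {S T : Multiset G} {k m : ℕ} (hS : HasLength S k) (hT : HasLength T m) :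
    HasLength (S + T) (k + m) := by
  obtain ⟨f, hf, rfl⟩ := hS
  obtain ⟨g, hg, rfl⟩ := hT
  refine ⟨Fin.append f g, fun i => ?_, ?_⟩
  · refine Fin.addCases (fun i => ?_) (fun i => ?_) i
    · simpa using hf i
    · simpa using hg i
  · simp [Fin.sum_univ_add]

theorem HasLength.productOne {S : Multiset G} {k : ℕ} (h : HasLength S k) : IsProductOne S := by
  obtain ⟨f, hf, rfl⟩ := h
  refine Finset.sum_induction f IsProductOne (fun _ _ => IsProductOne.add') IsProductOne.zero' ?_
  exact fun i _ => (hf i).2.1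

theorem mem_UL_add {k m k' m' : ℕ} (h : m ∈ UnionLengths G k) (h' : m' ∈ UnionLengths G k') :
    m + m' ∈ UnionLengths G (k + k') := by
  obtain ⟨a, ha, h1, h2⟩ := h
  obtain ⟨b, hb, h3, h4⟩ := h'
  exact ⟨a + b, ha.add' hb, h1.add' h3, h2.add' h4⟩

theorem mem_UL_mul {k m : ℕ} (h : m ∈ UnionLengths G k) (l : ℕ) :
    l * m ∈ UnionLengths G (l * k) := by
  induction l with
  | zero => simpa using ⟨0, IsProductOne.zero', HasLength.zero', HasLength.zero'⟩
  | succ l ih => rw [Nat.succ_mul, Nat.succ_mul]; exact mem_UL_add ih h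

theorem atom_pair {g : G} (hg : g ≠ 1) : IsMinimalProductOne ({g, g⁻¹} : Multiset G) := by
  refine ⟨by simp, ⟨[g, g⁻¹], rfl, by simp⟩, ?_⟩
  intro T₁ T₂ h1 h2 p1 p2 h
  have hc := congrArg Multiset.card h
  have c1 := Multiset.card_pos.2 h1
  have c2 := Multiset.card_pos.2 h2
  simp at hc
  obtain ⟨x, rfl⟩ := Multiset.card_eq_one.1 (show Multiset.card T₁ = 1 by omega)
  obtain ⟨l, hl, hp⟩ := p1
  rw [Multiset.coe_eq_singleton] at hl
  subst hl
  have hx : x ∈ ({g, g⁻¹} : Multiset G) := by rw [h]; simp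
  simp at hx hp
  subst hp
  rcases hx with hx | hx
  · exact hg hx.symm
  · exact hg (by simpa using hx.symm)

theorem atom_one : IsMinimalProductOne ({1} : Multiset G) := by
  refine ⟨by simp, ⟨[1], rfl, by simp⟩, ?_⟩
  intro T₁ T₂ h1 h2 p1 p2 h
  have hc := congrArg Multiset.card h
  have c1 := Multiset.card_pos.2 h1
  have c2 := Multiset.card_pos.2 h2
  simp at hc
  omega

theorem hasLength_pairs (A : Multiset G) (hA : (1 : G) ∉ A) :
    HasLength (A + A.map (·⁻¹)) (Multiset.card A) := by
  induction A using Multiset.induction with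
  | empty => simpa using HasLength.zero'
  | cons g A ih =>
    simp only [Multiset.mem_cons, not_or] at hA
    have := (ih hA.2).add' (HasLength.of_atom (atom_pair (Ne.symm hA.1)))
    convert this using 1
    · rw [Multiset.map_cons]
      simp only [Multiset.insert_eq_cons, ← Multiset.singleton_add]
      abel
    · simp

theorem productOne_map {H : Type*} [Group H] (e : G ≃* H) {S : Multiset G}
    (h : IsProductOne S) : IsProductOne (S.map e) := by
  obtain ⟨l, rfl, h⟩ := h
  exact ⟨l.map e, by simp, by rw [← map_list_prod, h, map_one]⟩

theorem atom_map {H : Type*} [Group H] (e : G ≃* H) {S : Multiset G}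
    (h : IsMinimalProductOne S) : IsMinimalProductOne (S.map e) := by
  obtain ⟨h0, h1, h2⟩ := h
  refine ⟨by simpa using h0, productOne_map e h1, ?_⟩
  intro T₁ T₂ n1 n2 p1 p2 h
  refine h2 (T₁.map e.symm) (T₂.map e.symm) (by simpa using n1) (by simpa using n2)
    (productOne_map e.symm p1) (productOne_map e.symm p2) ?_
  rw [← Multiset.map_add, ← h]
  simp

theorem hasLength_map {H : Type*} [Group H] (e : G ≃* H) {S : Multiset G} {k : ℕ}
    (h : HasLength S k) : HasLength (S.map e) k := by
  obtain ⟨f, hf, rfl⟩ := h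
  refine ⟨fun i => (f i).map e, fun i => atom_map e (hf i), ?_⟩
  exact (map_sum (Multiset.mapAddMonoidHom e) f Finset.univ).symm

theorem mem_UL_map {H : Type*} [Group H] (e : G ≃* H) {k m : ℕ}
    (h : m ∈ UnionLengths G k) : m ∈ UnionLengths H k := by
  obtain ⟨a, ha, h1, h2⟩ := h
  exact ⟨a.map e, productOne_map e ha, hasLength_map e h1, hasLength_map e h2⟩

theorem productOne_inv {S : Multiset G} (h : IsProductOne S) : IsProductOne (S.map (·⁻¹)) := by
  obtain ⟨l, rfl, h⟩ := h
  refine ⟨(l.map (·⁻¹)).reverse, ?_, ?_⟩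
  · rw [Multiset.coe_reverse]; rfl
  · rw [← List.prod_inv_reverse, h, inv_one]

theorem atom_inv {S : Multiset G} (h : IsMinimalProductOne S) :
    IsMinimalProductOne (S.map (·⁻¹)) := by
  obtain ⟨h0, h1, h2⟩ := h
  refine ⟨by simpa using h0, productOne_inv h1, ?_⟩
  intro T₁ T₂ n1 n2 p1 p2 h
  refine h2 (T₁.map (·⁻¹)) (T₂.map (·⁻¹)) (by simpa using n1) (by simpa using n2)
    (productOne_inv p1) (productOne_inv p2) ?_
  rw [← Multiset.map_add, ← h]
  simp

/-- Two atoms `A`, `A⁻¹` give `card A` atoms of length two. -/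
theorem two_mem_UL {A : Multiset G} (h : IsMinimalProductOne A) (h1 : (1 : G) ∉ A) :
    2 ∈ UnionLengths G (Multiset.card A) := by
  have := (HasLength.of_atom h).add' (HasLength.of_atom (atom_inv h))
  exact ⟨_, this.productOne, hasLength_pairs A h1, this⟩

theorem not_atom_of_hasLength {S : Multiset G} {k : ℕ} (h : HasLength S (k + 2)) :
    ¬ IsMinimalProductOne S := by
  obtain ⟨f, hf, rfl⟩ := h
  intro h
  rw [Fin.sum_univ_succ] at h
  have hL : HasLength (∑ i : Fin (k + 1), f i.succ) (k + 1) :=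
    ⟨fun i => f i.succ, fun i => hf _, rfl⟩
  refine h.2.2 _ _ (hf 0).1 ?_ (hf 0).2.1 hL.productOne rfl
  rw [Fin.sum_univ_succ]
  intro h0
  exact (hf (Fin.succ 0)).1 (add_eq_zero.1 h0).1

/-- The elementary bound `D(G) ≤ |G|`. -/
theorem atom_card_le [Fintype G] {S : Multiset G} (h : IsMinimalProductOne S) :
    Multiset.card S ≤ Fintype.card G := by
  by_contra hlt
  push Not at hlt
  obtain ⟨h0, ⟨l, rfl, hl⟩, h2⟩ := h
  simp only [Multiset.coe_card] at hlt
  obtain ⟨i, j, hij, he⟩ := Fintype.exists_ne_map_eq_of_card_lt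
    (fun i : Fin l.length => (l.take (i + 1)).prod) (by simpa using hlt)
  wlog hlt' : i < j generalizing i j
  · exact this j i hij.symm he.symm (lt_of_le_of_ne (not_lt.1 hlt') hij.symm)
  have hi := i.2
  have hj := j.2
  have hlt'' : (i : ℕ) < j := hlt'
  obtain ⟨d, hd⟩ : ∃ d, (j : ℕ) + 1 = (i + 1) + d := ⟨j - i, by omega⟩
  have e1 : l.take (j + 1) = l.take (i + 1) ++ (l.drop (i + 1)).take d := by
    rw [hd, List.take_add]
  have e2 : l = l.take (j + 1) ++ l.drop (j + 1) := (List.take_append_drop _ _).symm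
  have e3 : ((l.drop (i + 1)).take d).prod = 1 := by
    rw [e1, List.prod_append] at he
    simpa using he.symm
  have e4 : (l.take (i + 1) ++ l.drop (j + 1)).prod = 1 := by
    rw [List.prod_append, he, ← List.prod_append, ← e2, hl]
  refine h2 (l.take (i + 1) ++ l.drop (j + 1) : List G) ((l.drop (i + 1)).take d : List G)
    ?_ ?_ ⟨_, rfl, e4⟩ ⟨_, rfl, e3⟩ ?_
  · intro h
    have := congrArg Multiset.card h
    simp at this
    try omega
  · intro h
    have := congrArg Multiset.card h
    simp at this
    omega
  · conv_lhs => rw [e2, e1]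
    simp only [← Multiset.coe_add]
    abel

theorem atom_of_one_mem {S : Multiset G} (h : IsMinimalProductOne S) (h1 : (1 : G) ∈ S) :
    S = {1} := by
  obtain ⟨T, rfl⟩ := Multiset.exists_cons_of_mem h1
  obtain ⟨h0, ⟨l, hl, hp⟩, h2⟩ := h
  by_contra hne
  have hT : T ≠ 0 := by rintro rfl; exact hne rfl
  refine h2 {1} T (by simp) hT atom_one.2.1 ?_ (by simp)
  have hm : (1 : G) ∈ l := by
    rw [← Multiset.mem_coe, hl]; simp
  obtain ⟨s, t, rfl⟩ := List.append_of_mem hm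
  refine ⟨s ++ t, ?_, by simpa using hp⟩
  have : ((1 ::ₘ ((s ++ t : List G) : Multiset G))) = 1 ::ₘ T := by
    rw [← hl]
    simp only [← Multiset.singleton_add, ← Multiset.coe_add, ← Multiset.cons_coe]
    abel
  exact (Multiset.cons_inj_right _).1 this

open Classical in
theorem weight_bounds [Fintype G] (hc : 2 ≤ Fintype.card G) {S : Multiset G}
    (h : IsMinimalProductOne S) :
    2 ≤ Multiset.card S + S.count 1 ∧ Multiset.card S + S.count 1 ≤ Fintype.card G := by
  by_cases h1 : (1 : G) ∈ S
  · rw [atom_of_one_mem h h1]; simpa using hc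
  · have h0 := Multiset.count_eq_zero.2 h1
    have hle := atom_card_le h
    have hpos := Multiset.card_pos.2 h.1
    refine ⟨?_, by omega⟩
    by_contra hlt
    obtain ⟨x, rfl⟩ := Multiset.card_eq_one.1 (show Multiset.card S = 1 by omega)
    obtain ⟨l, hl, hp⟩ := h.2.1
    rw [Multiset.coe_eq_singleton] at hl
    subst hl
    simp at hp
    subst hp
    simp at h1

open Classical in
theorem UL_bound [Fintype G] (hc : 2 ≤ Fintype.card G) {k m : ℕ} (h : m ∈ UnionLengths G k) :
    2 * k ≤ Fintype.card G * m := by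
  obtain ⟨a, -, ⟨f, hf, hfa⟩, ⟨g, hg, hga⟩⟩ := h
  let w : Multiset G →+ ℕ := Multiset.cardHom + Multiset.countAddMonoidHom 1
  have hw : ∀ S, w S = Multiset.card S + S.count 1 := fun S => rfl
  have e1 : w a = ∑ i, w (f i) := by rw [← hfa, map_sum]
  have e2 : w a = ∑ i, w (g i) := by rw [← hga, map_sum]
  calc 2 * k = ∑ i : Fin k, 2 := by simp [mul_comm]
    _ ≤ ∑ i, w (f i) := Finset.sum_le_sum fun i _ => by
        rw [hw]; exact (weight_bounds hc (hf i)).1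
    _ = ∑ i, w (g i) := by rw [← e1, e2]
    _ ≤ ∑ i : Fin m, Fintype.card G := Finset.sum_le_sum fun i _ => by
        rw [hw]; exact (weight_bounds hc (hg i)).2
    _ = _ := by simp [mul_comm]

theorem UL_ge_two {k m : ℕ} (hk : 2 ≤ k) (h : m ∈ UnionLengths G k) : 2 ≤ m := by
  obtain ⟨a, -, h1, ⟨g, hg, hga⟩⟩ := h
  obtain ⟨k, rfl⟩ := Nat.exists_eq_add_of_le' hk
  by_contra hlt
  have : m = 0 ∨ m = 1 := by omega
  rcases this with rfl | rfl
  · obtain ⟨f, hf, hfa⟩ := h1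
    rw [Fin.sum_univ_succ, ← hga] at hfa
    simp at hfa
    exact (hf 0).1 hfa.1
  · simp at hga
    exact not_atom_of_hasLength h1 (hga ▸ hg 0)

end Generic

section Dihedral
open DihedralGroup

/-- Being a reflection. -/
def isRefl {n : ℕ} : DihedralGroup n → Bool
  | .r _ => false
  | .sr _ => true

theorem refl_even {n : ℕ} (l : List (DihedralGroup n)) :
    isRefl l.prod = decide (Odd (l.filter isRefl).length) := by
  induction l with
  | nil => rfl
  | cons g l ih =>
    rw [List.prod_cons]
    rcases hp : l.prod with z | z <;> rw [hp] at ih <;> rcases g with i | i <;>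
      simp_all [isRefl, List.filter_cons, Nat.odd_add_one, Nat.even_add_one]

theorem rot_normal {n : ℕ} (l : List (DihedralGroup n)) (h : ∀ g ∈ l, g = r 1 ∨ isRefl g) :
    ∃ u v : ℕ, u + v = l.count (r 1) ∧
      l.prod = (l.filter isRefl).prod * r ((u : ZMod n) - (v : ZMod n)) := by
  induction l with
  | nil => exact ⟨0, 0, by simp, by simp⟩
  | cons g l ih =>
    obtain ⟨u, v, huv, hp⟩ := ih (fun g hg => h g (List.mem_cons_of_mem _ hg))
    rcases h g List.mem_cons_self with rfl | hg
    · rw [List.prod_cons, hp]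
      have hf : (List.filter isRefl ((r 1 : DihedralGroup n) :: l)) = l.filter isRefl := by
        simp [isRefl]
      rw [hf]
      rcases (l.filter isRefl).prod with z | z
      · refine ⟨u + 1, v, by simp; omega, ?_⟩
        simp; ring
      · refine ⟨u, v + 1, by simp; omega, ?_⟩
        simp; ring
    · refine ⟨u, v, ?_, ?_⟩
      · rw [huv, List.count_cons_of_ne]
        rintro rfl
        simp [isRefl] at hg
      · rw [List.prod_cons, hp, List.filter_cons_of_pos hg, List.prod_cons, mul_assoc]

theorem atom1_aux {n : ℕ} (hodd : Odd n) (x y : ℕ) (hx : x < n) (hy : y < n)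
    (a b : ZMod n) (hab : a - b = x - y) (T₁ T₂ : Multiset (DihedralGroup n))
    (h : Multiset.replicate (x + y) (r 1) + {sr a, sr b} = T₁ + T₂)
    (n2 : T₂ ≠ 0) (p1 : IsProductOne T₁) (p2 : IsProductOne T₂)
    (hF2 : T₂.filter (fun g => isRefl g) = 0) : False := by
  have hmem : ∀ g ∈ T₁ + T₂, g = r 1 ∨ isRefl g := by
    intro g hg
    rw [← h] at hg
    simp only [Multiset.mem_add, Multiset.insert_eq_cons, Multiset.mem_cons,
      Multiset.mem_singleton] at hg
    rcases hg with hg | rfl | rfl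
    · exact Or.inl (Multiset.eq_of_mem_replicate hg)
    · exact Or.inr rfl
    · exact Or.inr rfl
  have hF : T₁.filter (fun g => isRefl g) = {sr a, sr b} := by
    have := congrArg (Multiset.filter (fun g => isRefl g = true)) h
    rw [Multiset.filter_add, Multiset.filter_add, hF2, add_zero] at this
    rw [← this]
    have h1 : Multiset.filter (fun g => isRefl g = true)
        (Multiset.replicate (x + y) (r 1 : DihedralGroup n)) = 0 := by
      rw [Multiset.filter_eq_nil]
      intro g hg
      rw [Multiset.eq_of_mem_replicate hg]
      simp [isRefl]
    rw [h1]
    rw [Multiset.insert_eq_cons, Multiset.filter_cons_of_pos _ (by rfl),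
      Multiset.filter_singleton, if_pos (by rfl)]
    simp
  have hcnt : T₁.count (r 1) + T₂.count (r 1) = x + y := by
    rw [← Multiset.count_add, ← h, Multiset.count_add, Multiset.count_replicate_self]
    simp
  have hT2 : T₂ = Multiset.replicate (Multiset.card T₂) (r 1) := by
    rw [Multiset.eq_replicate]
    refine ⟨rfl, fun g hg => ?_⟩
    rcases hmem g (Multiset.mem_add.2 (Or.inr hg)) with h | h
    · exact h
    · rw [Multiset.filter_eq_nil] at hF2
      exact absurd h (hF2 g hg)
  have hpos := Multiset.card_pos.2 n2
  set i := Multiset.card T₂ with hi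
  have hni : n ∣ i := by
    obtain ⟨l, hl, hp⟩ := p2
    rw [hT2] at hl
    rw [← Multiset.coe_replicate, Multiset.coe_eq_coe, List.perm_replicate] at hl
    rw [hl] at hp
    simp only [List.prod_replicate, r_one_pow] at hp
    rw [← r_zero] at hp
    exact (ZMod.natCast_eq_zero_iff _ _).1 (r.inj hp)
  have hci : T₂.count (r 1) = i := by
    rw [hT2, Multiset.count_replicate_self]
  obtain ⟨l, rfl, hp⟩ := p1
  obtain ⟨u, v, huv, hp'⟩ := rot_normal l
    (fun g hg => hmem g (Multiset.mem_add.2 (Or.inl (by simpa using hg))))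
  rw [Multiset.coe_count] at hcnt
  have hperm : (l.filter isRefl).Perm [sr a, sr b] := by
    rw [← Multiset.coe_eq_coe]
    rw [Multiset.filter_coe] at hF
    simp only [Bool.decide_eq_true] at hF
    exact hF
  have hz : ((i : ℕ) : ZMod n) = 0 := (ZMod.natCast_eq_zero_iff _ _).2 hni
  have hsum : (u : ZMod n) + v = x + y := by
    have : u + v + i = x + y := by omega
    have := congrArg (Nat.cast : ℕ → ZMod n) this
    push_cast at this
    rw [hz] at this
    simpa using this
  have h2 : IsUnit (2 : ZMod n) := by
    have := (ZMod.isUnit_iff_coprime 2 n).2 (Nat.coprime_two_left.2 hodd)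
    simpa using this
  have key : ∀ p q : ℕ, q < n → (p : ZMod n) = q → q ≤ p := by
    intro p q hq hpq
    rw [ZMod.natCast_eq_natCast_iff'] at hpq
    rw [Nat.mod_eq_of_lt hq] at hpq
    rw [← hpq]
    exact Nat.mod_le _ _
  have hcase : (u : ZMod n) - v = x - y ∨ (u : ZMod n) - v = y - x := by
    rw [hp] at hp'
    have hl2 : (l.filter isRefl) = [sr a, sr b] ∨ (l.filter isRefl) = [sr b, sr a] := by
      rcases hll : l.filter isRefl with _ | ⟨c, _ | ⟨d, _ | _⟩⟩
      · rw [hll] at hperm; simpa using hperm.length_eq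
      · rw [hll] at hperm; simpa using hperm.length_eq
      · rw [hll] at hperm
        have := List.perm_pair.1 hperm
        simpa using this
      · rw [hll] at hperm; simpa using hperm.length_eq
    rcases hl2 with hl2 | hl2 <;> rw [hl2] at hp' <;>
      simp only [List.prod_cons, List.prod_nil, mul_one, sr_mul_sr, r_mul_r] at hp' <;>
      rw [← r_zero] at hp' <;>
      have := r.inj hp'
    · left; linear_combination hab - this
    · right; linear_combination -hab - this
  rcases hcase with hc | hc
  · have e1 : (u : ZMod n) = x := h2.mul_left_cancel (by linear_combination hsum + hc)
    have e2 : (v : ZMod n) = y := by linear_combination hsum - e1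
    have := key _ _ hx e1
    have := key _ _ hy e2
    omega
  · have e1 : (u : ZMod n) = y := h2.mul_left_cancel (by linear_combination hsum + hc)
    have e2 : (v : ZMod n) = x := by linear_combination hsum - e1
    have := key _ _ hy e1
    have := key _ _ hx e2
    omega

theorem atom1 {n : ℕ} (hodd : Odd n) (x y : ℕ) (hx : x < n) (hy : y < n)
    (a b : ZMod n) (hab : a - b = x - y) :
    IsMinimalProductOne
      (Multiset.replicate (x + y) (r 1) + {sr a, sr b} : Multiset (DihedralGroup n)) := by
  refine ⟨by simp, ?_, ?_⟩
  · refine ⟨List.replicate x (r 1) ++ (sr a :: (List.replicate y (r 1) ++ [sr b])), ?_, ?_⟩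
    · rw [Multiset.replicate_add]
      simp only [← Multiset.coe_add, ← Multiset.cons_coe, Multiset.coe_replicate,
        ← Multiset.singleton_add, Multiset.insert_eq_cons, Multiset.coe_singleton, Multiset.coe_nil]
      abel
    · simp only [List.prod_append, List.prod_replicate, List.prod_cons, r_one_pow,
        List.prod_nil, mul_one, r_mul_sr, sr_mul_sr]
      rw [r_mul_r, ← r_zero, r.injEq]
      linear_combination -hab
  · intro T₁ T₂ n1 n2 p1 p2 h
    have hF := congrArg (fun S => Multiset.card (Multiset.filter (fun g => isRefl g = true) S)) h
    have e0 : Multiset.card (Multiset.filter (fun g => isRefl g = true)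
        (Multiset.replicate (x + y) (r 1) + {sr a, sr b} : Multiset (DihedralGroup n))) = 2 := by
      have h1 : Multiset.filter (fun g => isRefl g = true)
          (Multiset.replicate (x + y) (r 1 : DihedralGroup n)) = 0 := by
        rw [Multiset.filter_eq_nil]
        intro g hg
        rw [Multiset.eq_of_mem_replicate hg]
        simp [isRefl]
      rw [Multiset.filter_add, h1]
      rw [Multiset.insert_eq_cons, Multiset.filter_cons_of_pos _ (by rfl),
        Multiset.filter_singleton, if_pos (by rfl)]
      simp
    simp only [e0] at hF
    rw [Multiset.filter_add, Multiset.card_add] at hF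
    have hev : ∀ T : Multiset (DihedralGroup n), IsProductOne T →
        Even (Multiset.card (Multiset.filter (fun g => isRefl g = true) T)) := by
      rintro T ⟨l, rfl, hp⟩
      have := refl_even l
      rw [hp, one_def] at this
      simp [isRefl] at this
      simpa using this
    obtain ⟨c1, hc1⟩ := hev _ p1
    obtain ⟨c2, hc2⟩ := hev _ p2
    rcases Nat.eq_zero_or_pos c2 with h0 | h0
    · exact atom1_aux hodd x y hx hy a b hab T₁ T₂ h n2 p1 p2
        (Multiset.card_eq_zero.1 (by omega))
    · exact atom1_aux hodd x y hx hy a b hab T₂ T₁ (by rw [h, add_comm]) n1 p2 p1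
        (Multiset.card_eq_zero.1 (by omega))

theorem refl_lists {n : ℕ} (a d : ZMod n) (hd : d ≠ 0) (l : List (DihedralGroup n))
    (h : ∀ g ∈ l, g = sr a ∨ g = sr (a + d)) :
    ∃ s t h : ℕ, s + t = l.count (sr (a + d)) ∧ t ≤ h ∧
      ((l.count (sr a) + l.count (sr (a + d)) = 2 * h ∧ s ≤ h ∧
          l.prod = r (((t : ZMod n) - (s : ZMod n)) * d)) ∨
       (l.count (sr a) + l.count (sr (a + d)) = 2 * h + 1 ∧ s ≤ h + 1 ∧
          l.prod = sr (a + ((s : ZMod n) - (t : ZMod n)) * d))) := by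
  induction l with
  | nil => exact ⟨0, 0, 0, by simp, by simp, Or.inl (by simp)⟩
  | cons g l ih =>
    have hne : (sr a : DihedralGroup n) ≠ sr (a + d) := by
      intro h; have := sr.inj h; simp at this; exact hd this
    obtain ⟨s, t, h', hst, ht, H⟩ := ih (fun g hg => h g (List.mem_cons_of_mem _ hg))
    rcases h g List.mem_cons_self with rfl | rfl
    · rw [List.count_cons_self, List.count_cons_of_ne hne, List.prod_cons]
      rcases H with ⟨hc, hs, hp⟩ | ⟨hc, hs, hp⟩
      · refine ⟨t, s, h', by omega, by omega, Or.inr ⟨by omega, by omega, ?_⟩⟩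
        rw [hp, sr_mul_r]
      · refine ⟨t, s, h' + 1, by omega, by omega, Or.inl ⟨by omega, by omega, ?_⟩⟩
        rw [hp, sr_mul_sr]; congr 1; ring
    · rw [List.count_cons_self, List.count_cons_of_ne hne.symm, List.prod_cons]
      rcases H with ⟨hc, hs, hp⟩ | ⟨hc, hs, hp⟩
      · refine ⟨t + 1, s, h', by omega, by omega, Or.inr ⟨by omega, by omega, ?_⟩⟩
        rw [hp, sr_mul_r]; congr 1; push_cast; ring
      · refine ⟨t + 1, s, h' + 1, by omega, by omega, Or.inl ⟨by omega, by omega, ?_⟩⟩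
        rw [hp, sr_mul_sr]; congr 1; push_cast; ring

theorem atom2 {n : ℕ} (hn : 3 ≤ n) (hodd : Odd n) (a d : ZMod n) (hd : IsUnit d) :
    IsMinimalProductOne (Multiset.replicate n (sr a) + Multiset.replicate n (sr (a + d)) :
      Multiset (DihedralGroup n)) := by
  have : Fact (1 < n) := ⟨by omega⟩
  have hd0 : d ≠ 0 := hd.ne_zero
  have hne : (sr a : DihedralGroup n) ≠ sr (a + d) := by
    intro h; have := sr.inj h; simp at this; exact hd0 this
  refine ⟨?_, ?_, ?_⟩
  · intro h
    have := congrArg Multiset.card h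
    simp at this
    omega
  · have : ∀ m : ℕ, ∃ l : List (DihedralGroup n),
        (l : Multiset (DihedralGroup n)) =
          Multiset.replicate m (sr a) + Multiset.replicate m (sr (a + d)) ∧
        l.prod = r ((m : ZMod n) * d) := by
      intro m
      induction m with
      | zero => exact ⟨[], by simp, by simp⟩
      | succ m ih =>
        obtain ⟨l, hl, hp⟩ := ih
        refine ⟨sr a :: sr (a + d) :: l, ?_, ?_⟩
        · simp only [← Multiset.cons_coe, hl, Multiset.replicate_succ, ← Multiset.singleton_add]
          abel
        · rw [List.prod_cons, List.prod_cons, hp, ← mul_assoc, sr_mul_sr, r_mul_r]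
          congr 1; push_cast; ring
    obtain ⟨l, hl, hp⟩ := this n
    exact ⟨l, hl, by rw [hp]; simp⟩
  · intro T₁ T₂ n1 n2 p1 p2 h
    have ca : T₁.count (sr a) + T₂.count (sr a) = n := by
      rw [← Multiset.count_add, ← h, Multiset.count_add, Multiset.count_replicate_self,
        Multiset.count_replicate, if_neg hne.symm, add_zero]
    have cb : T₁.count (sr (a + d)) + T₂.count (sr (a + d)) = n := by
      rw [← Multiset.count_add, ← h, Multiset.count_add, Multiset.count_replicate_self,
        Multiset.count_replicate, if_neg hne, zero_add]
    have hmem : ∀ g ∈ T₁ + T₂, g = sr a ∨ g = sr (a + d) := by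
      intro g hg
      rw [← h, Multiset.mem_add] at hg
      exact hg.imp Multiset.eq_of_mem_replicate Multiset.eq_of_mem_replicate
    have key : ∀ T : Multiset (DihedralGroup n), IsProductOne T → (∀ g ∈ T, g ∈ T₁ + T₂) →
        T.count (sr (a + d)) ≤ n → T.count (sr a) ≤ n →
        (n = T.count (sr a) ∧ n = T.count (sr (a + d))) ∨ Even (T.count (sr a)) := by
      rintro T ⟨l, rfl, hp⟩ hT h1 h2
      obtain ⟨s, t, h', hst, ht, H⟩ := refl_lists a d hd0 l
        (fun g hg => hmem g (hT g (by simpa using hg)))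
      simp only [Multiset.coe_count] at h1 h2 ⊢
      rcases H with ⟨hc, hs, hp'⟩ | ⟨hc, hs, hp'⟩
      · rw [hp, ← r_zero] at hp'
        have hz : ((t : ZMod n) - s) * d = 0 := (r.inj hp').symm
        rw [hd.mul_left_eq_zero, sub_eq_zero] at hz
        have hdvd : (n : ℤ) ∣ (t : ℤ) - s := by
          rw [← ZMod.intCast_zmod_eq_zero_iff_dvd]
          push_cast
          rw [hz, sub_self]
        obtain ⟨q, hq⟩ := hdvd
        have hq1 : q < 2 := by nlinarith
        have hq2 : -2 < q := by nlinarith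
        have hq3 : q = -1 ∨ q = 0 ∨ q = 1 := by omega
        rcases hq3 with rfl | rfl | rfl
        · left; omega
        · right
          rw [Nat.even_iff]; omega
        · left; omega
      · rw [hp, ← r_zero] at hp'
        cases hp'
    have zero : ∀ T : Multiset (DihedralGroup n), (∀ g ∈ T, g ∈ T₁ + T₂) →
        T.count (sr a) = 0 → T.count (sr (a + d)) = 0 → T = 0 := by
      intro T hT h1 h2
      rw [Multiset.eq_zero_iff_forall_notMem]
      intro g hg
      rcases hmem g (hT g hg) with rfl | rfl
      · exact Multiset.count_eq_zero.1 h1 hg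
      · exact Multiset.count_eq_zero.1 h2 hg
    have m1 : ∀ g ∈ T₁, g ∈ T₁ + T₂ := fun g hg => Multiset.mem_add.2 (Or.inl hg)
    have m2 : ∀ g ∈ T₂, g ∈ T₁ + T₂ := fun g hg => Multiset.mem_add.2 (Or.inr hg)
    rcases key T₁ p1 m1 (by omega) (by omega) with ⟨k1, k2⟩ | k1
    · exact n2 (zero T₂ m2 (by omega) (by omega))
    rcases key T₂ p2 m2 (by omega) (by omega) with ⟨k3, k4⟩ | k3
    · exact n1 (zero T₁ m1 (by omega) (by omega))
    have := k1.add k3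
    rw [ca] at this
    exact (Nat.not_even_iff_odd.2 hodd) this

theorem one_ne_sr {n : ℕ} (a : ZMod n) : (1 : DihedralGroup n) ≠ sr a := by
  rw [one_def]; intro h; cases h

theorem one_ne_r {n : ℕ} (hn : 3 ≤ n) : (1 : DihedralGroup n) ≠ r 1 := by
  have : Fact (1 < n) := ⟨by omega⟩
  rw [one_def]; intro h
  exact zero_ne_one (r.inj h)

theorem UL_two {n : ℕ} (hn : 3 ≤ n) (hodd : Odd n) (j : ℕ) (h2 : 2 ≤ j) (hj : j ≤ 2 * n) :
    2 ∈ UnionLengths (DihedralGroup n) j := by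
  obtain ⟨x, y, hxy, hx, hy⟩ : ∃ x y, x + y + 2 = j ∧ x < n ∧ y < n :=
    ⟨(j - 2) / 2, (j - 2) - (j - 2) / 2, by omega, by omega, by omega⟩
  have := two_mem_UL (atom1 hodd x y hx hy ((x : ZMod n) - y) 0 (by ring)) (by
    intro h
    simp only [Multiset.mem_add, Multiset.insert_eq_cons, Multiset.mem_cons,
      Multiset.mem_singleton, one_ne_sr, or_false] at h
    exact one_ne_r hn (Multiset.eq_of_mem_replicate h))
  convert this using 1
  simp [← hxy]

theorem UL_of_three {H : Type*} [Group H] {A B C D : Multiset H} (hA : IsMinimalProductOne A)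
    (hB : IsMinimalProductOne B) (hC : IsMinimalProductOne C) (h1 : (1 : H) ∉ D)
    (h : A + B + C = D + D.map (·⁻¹)) : 3 ∈ UnionLengths H (Multiset.card D) := by
  have := ((HasLength.of_atom hA).add' (HasLength.of_atom hB)).add' (HasLength.of_atom hC)
  exact ⟨_, this.productOne, h ▸ hasLength_pairs D h1, this⟩

theorem UL_three_aux {n : ℕ} (hn : 3 ≤ n) (hodd : Odd n) (R : ℕ) (q : ZMod n)
    (hB : IsMinimalProductOne
      (Multiset.replicate R (r 1) + {sr 2, sr q} : Multiset (DihedralGroup n)))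
    (hC : IsMinimalProductOne
      (Multiset.replicate R (r 1) + {sr q, sr 0} : Multiset (DihedralGroup n))) :
    3 ∈ UnionLengths (DihedralGroup n) (R + n + 2) := by
  have h2 : IsUnit (2 : ZMod n) := by
    have := (ZMod.isUnit_iff_coprime 2 n).2 (Nat.coprime_two_left.2 hodd)
    simpa using this
  have hA := atom2 hn hodd 0 2 h2
  rw [zero_add] at hA
  obtain ⟨m, hm⟩ := hodd
  let D : Multiset (DihedralGroup n) := Multiset.replicate R (r 1) + {sr q} +
    Multiset.replicate (m + 1) (sr 0) + Multiset.replicate (m + 1) (sr 2)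
  have := UL_of_three (D := D) hA hB (atom_inv hC) ?_ ?_
  · convert this using 2
    simp [D]; omega
  · intro h
    simp only [D, Multiset.mem_add, Multiset.mem_singleton] at h
    rcases h with ((h | h) | h) | h
    · exact one_ne_r hn (Multiset.eq_of_mem_replicate h)
    · exact one_ne_sr _ h
    · exact one_ne_sr _ (Multiset.eq_of_mem_replicate h)
    · exact one_ne_sr _ (Multiset.eq_of_mem_replicate h)
  · have e : ∀ g : DihedralGroup n, Multiset.replicate n g =
        Multiset.replicate m g + Multiset.replicate m g + {g} := by
      intro g
      rw [← Multiset.replicate_one, ← Multiset.replicate_add, ← Multiset.replicate_add]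
      congr 1; omega
    rw [e, e]
    simp only [D, Multiset.map_add, Multiset.map_replicate, Multiset.map_singleton,
      Multiset.insert_eq_cons, Multiset.map_cons, inv_sr, inv_r, ← Multiset.singleton_add,
      Multiset.replicate_add, Multiset.replicate_one]
    abel

theorem UL_three {n : ℕ} (hn : 3 ≤ n) (hodd : Odd n) (j : ℕ) (h2 : 2 ≤ j) (hj : j ≤ n) :
    3 ∈ UnionLengths (DihedralGroup n) (2 * n + j) := by
  rcases Nat.lt_or_ge j n with hlt | hge
  · obtain ⟨R, hR⟩ : ∃ R, R + n + 2 = 2 * n + j := ⟨n + j - 2, by omega⟩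
    rw [← hR]
    rcases Nat.even_or_odd' R with ⟨m, hm | hm⟩
    · obtain ⟨m, rfl⟩ : ∃ m', m = m' + 1 := ⟨m - 1, by omega⟩
      refine UL_three_aux hn hodd R 2 ?_ ?_
      · have := atom1 hodd (m + 1) (m + 1) (by omega) (by omega) 2 2 (by simp)
        convert this using 3; omega
      · have := atom1 hodd (m + 2) m (by omega) (by omega) 2 0 (by simp)
        convert this using 3; omega
    · refine UL_three_aux hn hodd R 1 ?_ ?_
      · have := atom1 hodd (m + 1) m (by omega) (by omega) 2 1 (by push_cast; ring)
        convert this using 3; omega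
      · have := atom1 hodd (m + 1) m (by omega) (by omega) 1 0 (by simp)
        convert this using 3; omega
  · obtain rfl : j = n := by omega
    have h2 : IsUnit (2 : ZMod j) := by
      have := (ZMod.isUnit_iff_coprime 2 j).2 (Nat.coprime_two_left.2 hodd)
      simpa using this
    have hA := atom2 hn hodd 0 1 isUnit_one
    have hB := atom2 hn hodd 1 1 isUnit_one
    have hC := atom2 hn hodd 0 2 h2
    rw [zero_add] at hA hC
    rw [one_add_one_eq_two] at hB
    have := UL_of_three (D := (Multiset.replicate j (sr 0) + Multiset.replicate j (sr 1) +
      Multiset.replicate j (sr 2) : Multiset (DihedralGroup j))) hA hB hC ?_ ?_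
    · convert this using 2
      simp; omega
    · intro h
      simp only [Multiset.mem_add] at h
      rcases h with (h | h) | h <;> exact one_ne_sr _ (Multiset.eq_of_mem_replicate h)
    · simp only [Multiset.map_add, Multiset.map_replicate, inv_sr]
      abel

end Dihedral

theorem lambdaK_eq {G : Type*} [Group G] {k m : ℕ} (h : m ∈ UnionLengths G k)
    (hle : ∀ m' ∈ UnionLengths G k, m ≤ m') : lambdaK G k = m :=
  le_antisymm (Nat.sInf_le h) (le_csInf ⟨m, h⟩ hle)

theorem lambda_values_dihedral_odd
    (n : ℕ) (hn : 3 ≤ n) (hodd : Odd n)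
    (G : Type*) [Group G] (hG : Nonempty (G ≃* DihedralGroup n))
    (l j : ℕ) (hj : j ≤ 2 * n - 1) (h1 : 1 ≤ 2 * l * n + j) :
    (j ≤ 1 → lambdaK G (2 * l * n + j) = 2 * l + j) ∧
    (2 ≤ j → l = 0 → lambdaK G (2 * l * n + j) = 2) ∧
    (2 ≤ j → j ≤ n → 1 ≤ l → lambdaK G (2 * l * n + j) = 2 * l + 1) ∧
    (n + 1 ≤ j → j ≤ 2 * n - 1 → 1 ≤ l → lambdaK G (2 * l * n + j) = 2 * l + 2) := by
  obtain ⟨e⟩ := hG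
  have : NeZero n := ⟨by omega⟩
  letI : Fintype G := Fintype.ofEquiv _ e.symm.toEquiv
  have hcard : Fintype.card G = 2 * n := by
    rw [Fintype.card_congr e.toEquiv, DihedralGroup.card]
  have bound : ∀ k m, m ∈ UnionLengths G k → k ≤ n * m := by
    intro k m h
    have := UL_bound (by omega) h
    rw [hcard, mul_assoc] at this
    omega
  have base : ∀ l : ℕ, l * 2 ∈ UnionLengths G (l * (2 * n)) := fun l =>
    mem_UL_mul (mem_UL_map e.symm (UL_two hn hodd (2 * n) (by omega) le_rfl)) l
  refine ⟨fun hj1 => ?_, fun hj2 hl => ?_, fun hj2 hjn hl => ?_, fun hj1 hj2 hl => ?_⟩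
  · refine lambdaK_eq ?_ ?_
    · have hone : (1 : ℕ) ∈ UnionLengths G 1 :=
        ⟨{1}, atom_one.2.1, HasLength.of_atom atom_one, HasLength.of_atom atom_one⟩
      convert mem_UL_add (base l) (mem_UL_mul hone j) using 1
      · congr 1; ring
      · ring
    · intro m hm
      have := bound _ _ hm
      by_contra hlt
      have h3 : m + 1 ≤ 2 * l + j := by omega
      have h4 : j = 0 ∨ j = 1 := by omega
      rcases h4 with rfl | rfl
      · nlinarith
      · nlinarith [Nat.mul_le_mul_left n (show m ≤ 2 * l by omega)]
  · subst hl
    refine lambdaK_eq ?_ ?_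
    · simpa using mem_UL_map e.symm (UL_two hn hodd j hj2 (by omega))
    · intro m hm
      exact UL_ge_two (by simpa using hj2) hm
  · refine lambdaK_eq ?_ ?_
    · obtain ⟨l, rfl⟩ : ∃ l', l = l' + 1 := ⟨l - 1, by omega⟩
      convert mem_UL_add (base l) (mem_UL_map e.symm (UL_three hn hodd j hj2 hjn)) using 1
      · congr 1; ring
      · ring
    · intro m hm
      have := bound _ _ hm
      by_contra hlt
      nlinarith [Nat.mul_le_mul_left n (show m ≤ 2 * l by omega)]
  · refine lambdaK_eq ?_ ?_
    · convert mem_UL_add (base l) (mem_UL_map e.symm (UL_two hn hodd j (by omega) (by omega)))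
        using 1
      · congr 1; ring
      · ring
    · intro m hm
      have := bound _ _ hm
      by_contra hlt
      nlinarith [Nat.mul_le_mul_left n (show m ≤ 2 * l + 1 by omega)]
end
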